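/- Let n ≥ 1, let 1 < u < ∞, 1 ≤ q < ∞, and let α ∈ ℝ satisfy −n/u < α < n − n/u. Let 1 < p < ∞ and let N : [1,∞) → (0,∞) be increasing. Then there exists a constant C > 0 such that ‖f‖_{Ḱ^{α,q}_u} ≤ C‖g‖_{Ḱ^{α,q}_u} for every pair (f,g) ∈ F(p,N), where the homogeneous Herz norm is ‖h‖_{Ḱ^{α,q}_u} := (∑_{k∈ℤ} (2^{kα} ‖h·χ_{C_k}‖_{L^u})^q)^{1/q} with C_k := B(0,2^k) \ B(0,2^{k−1}). -/

import Mathlib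

open MeasureTheory ENNReal NNReal Filter Topology

noncomputable section

/-- Euclidean space ℝⁿ. -/
abbrev Eucl (n : ℕ) := EuclideanSpace ℝ (Fin n)

/-- The axes-parallel closed cube with center `x` and radius `r`. -/
def cubeSet {n : ℕ} (x : Eucl n) (r : ℝ) : Set (Eucl n) :=
  {y | ∀ i, |x i - y i| ≤ r}

/-- The Muckenhoupt `A_p` characteristic
`[w]_{A_p} = sup_Q (|Q|⁻¹∫_Q w) (|Q|⁻¹∫_Q w^{-1/(p-1)})^{p-1}`. -/
def apConst (n : ℕ) (p : ℝ) (w : Eucl n → ℝ≥0∞) : ℝ≥0∞ :=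
  ⨆ (x : Eucl n) (r : ℝ) (_ : 0 < r),
    ((volume (cubeSet x r))⁻¹ * ∫⁻ y in cubeSet x r, w y) *
      ((volume (cubeSet x r))⁻¹ * ∫⁻ y in cubeSet x r, w y ^ (-(1/(p-1)))) ^ (p-1)

/-- A weight: measurable, positive and finite a.e. -/
def IsWeight {n : ℕ} (w : Eucl n → ℝ≥0∞) : Prop :=
  Measurable w ∧ ∀ᵐ x ∂(volume : Measure (Eucl n)), 0 < w x ∧ w x < ⊤

/-- `w ∈ A_p`. -/
def MemAp (n : ℕ) (p : ℝ) (w : Eucl n → ℝ≥0∞) : Prop :=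
  IsWeight w ∧ apConst n p w < ⊤

/-- The weighted Lebesgue norm, for an `ℝ≥0∞`-valued function. -/
def wLpE (n : ℕ) (p : ℝ) (w : Eucl n → ℝ≥0∞) (F : Eucl n → ℝ≥0∞) : ℝ≥0∞ :=
  (∫⁻ x, F x ^ p * w x) ^ (1/p)

/-- The weighted Lebesgue norm `‖f‖_{L^p(w)} = (∫ |f|^p w)^{1/p}`. -/
def wLp (n : ℕ) (p : ℝ) (w : Eucl n → ℝ≥0∞) (f : Eucl n → ℝ) : ℝ≥0∞ :=
  wLpE n p w (fun x => (‖f x‖₊ : ℝ≥0∞))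

/-- The extrapolation family `F(p,N)`: pairs of measurable functions `(f,g)` with
`‖f‖_{L^p(w)} ≤ N([w]_{A_p}) ‖g‖_{L^p(w)}` for every `w ∈ A_p`. -/
def memF (n : ℕ) (p : ℝ) (N : ℝ → ℝ) (f g : Eucl n → ℝ) : Prop :=
  Measurable f ∧ Measurable g ∧
    ∀ w : Eucl n → ℝ≥0∞, MemAp n p w →
      wLp n p w f ≤ ENNReal.ofReal (N ((apConst n p w).toReal)) * wLp n p w g

/-- The homogeneous Herz norm
`‖h‖ = (∑_{k∈ℤ} (2^{kα} ‖h χ_{C_k}‖_{L^u})^q)^{1/q}`, `C_k = B(0,2^k) \ B(0,2^{k-1})`. -/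
def herzNorm (n : ℕ) (α u q : ℝ) (h : Eucl n → ℝ) : ℝ≥0∞ :=
  (∑' k : ℤ, ((2 : ℝ≥0∞) ^ ((k : ℝ) * α) *
      (∫⁻ y in Metric.ball (0 : Eucl n) ((2:ℝ) ^ k) \ Metric.ball (0 : Eucl n) ((2:ℝ) ^ (k-1)),
        (‖h y‖₊ : ℝ≥0∞) ^ u) ^ (1/u)) ^ q) ^ (1/q)


/-! ### Cubes -/

lemma cubeSet_eq_preimage {n : ℕ} (x : Eucl n) {r : ℝ} (hr : 0 ≤ r) :
    cubeSet x r = (WithLp.ofLp : Eucl n → (Fin n → ℝ)) ⁻¹' (Metric.closedBall (WithLp.ofLp x) r) := by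
  ext y
  simp only [cubeSet, Set.mem_ofPred_eq, Set.mem_preimage, Metric.mem_closedBall]
  rw [dist_comm, dist_pi_le_iff hr]
  rfl

lemma measurableSet_cubeSet {n : ℕ} (x : Eucl n) (r : ℝ) : MeasurableSet (cubeSet x r) := by
  have : IsClosed (cubeSet x r) := by
    unfold cubeSet
    simp only [Set.ofPred_forall]
    exact isClosed_iInter fun i => isClosed_le (by fun_prop) (by fun_prop)
  exact this.measurableSet

lemma volume_cubeSet {n : ℕ} (x : Eucl n) {r : ℝ} (hr : 0 ≤ r) :
    volume (cubeSet x r) = ENNReal.ofReal ((2 * r) ^ n) := by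
  rw [cubeSet_eq_preimage x hr,
    (PiLp.volume_preserving_ofLp (Fin n)).measure_preimage
      (Metric.isClosed_closedBall.measurableSet.nullMeasurableSet),
    Real.volume_pi_closedBall _ hr]
  simp

lemma volume_cubeSet_ne_zero {n : ℕ} (x : Eucl n) {r : ℝ} (hr : 0 < r) :
    volume (cubeSet x r) ≠ 0 := by
  rw [volume_cubeSet x hr.le]
  simp only [ne_eq, ENNReal.ofReal_eq_zero, not_le]
  positivity

lemma volume_cubeSet_ne_top {n : ℕ} (x : Eucl n) {r : ℝ} (hr : 0 < r) :
    volume (cubeSet x r) ≠ ⊤ := by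
  rw [volume_cubeSet x hr.le]
  exact ENNReal.ofReal_ne_top

lemma volume_cubeSet_mul {n : ℕ} (x : Eucl n) (y : Eucl n) {r : ℝ} (hr : 0 < r) {c : ℝ} (hc : 0 ≤ c) :
    volume (cubeSet x (c * r)) = ENNReal.ofReal (c ^ n) * volume (cubeSet y r) := by
  rw [volume_cubeSet x (by positivity), volume_cubeSet y hr.le, ← ENNReal.ofReal_mul (by positivity)]
  congr 1
  ring

lemma mem_cubeSet_self {n : ℕ} (x : Eucl n) {r : ℝ} (hr : 0 ≤ r) : x ∈ cubeSet x r := by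
  intro i; simpa using hr

lemma cubeSet_mono {n : ℕ} (x : Eucl n) {r s : ℝ} (h : r ≤ s) : cubeSet x r ⊆ cubeSet x s :=
  fun _ hy i => (hy i).trans h

lemma cubeSet_subset_of_inter {n : ℕ} (x y : Eucl n) {r s : ℝ}
    (hne : (cubeSet x r ∩ cubeSet y s).Nonempty) (hrs : r ≤ 2 * s) :
    cubeSet x r ⊆ cubeSet y (5 * s) := by
  obtain ⟨z, hz1, hz2⟩ := hne
  intro t ht i
  have h1 := abs_le.1 (hz1 i)
  have h2 := abs_le.1 (hz2 i)
  have h3 := abs_le.1 (ht i)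
  rw [abs_le]
  constructor <;> linarith [h1.1, h1.2, h2.1, h2.2, h3.1, h3.2]

/-- Countable family of cubes. -/
abbrev QIdx (n : ℕ) := (Fin n → ℚ) × {q : ℚ // 0 < q}

def qc {n : ℕ} (i : QIdx n) : Eucl n := WithLp.toLp 2 (fun j => ((i.1 j : ℚ) : ℝ))
def qr {n : ℕ} (i : QIdx n) : ℝ := ((i.2 : ℚ) : ℝ)
def qcube {n : ℕ} (i : QIdx n) : Set (Eucl n) := cubeSet (qc i) (qr i)

lemma qr_pos {n : ℕ} (i : QIdx n) : 0 < qr i := by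
  have := i.2.2
  unfold qr; exact_mod_cast this

lemma exists_qcube {n : ℕ} (x : Eucl n) {r : ℝ} (hr : 0 < r) :
    ∃ i : QIdx n, cubeSet x r ⊆ qcube i ∧
      volume (qcube i) ≤ ENNReal.ofReal (2 ^ n) * volume (cubeSet x r) := by
  have h1 : ∀ j, ∃ c : ℚ, x j - r / 2 < c ∧ (c : ℝ) < x j + r / 2 :=
    fun j => exists_rat_btwn (by linarith)
  choose c hc1 hc2 using h1
  obtain ⟨q, hq1, hq2⟩ := exists_rat_btwn (show 3 * r / 2 < 2 * r by linarith)
  have hq0 : (0 : ℝ) < q := by linarith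
  refine ⟨(c, ⟨q, by exact_mod_cast hq0⟩), ?_, ?_⟩
  · intro y hy i
    have h3 := abs_le.1 (hy i)
    have := hc1 i
    have := hc2 i
    simp only [qc, qr]
    rw [abs_le]
    constructor <;> linarith [h3.1, h3.2]
  · rw [← volume_cubeSet_mul x x hr (by norm_num)]
    unfold qcube
    rw [volume_cubeSet _ (qr_pos _).le, volume_cubeSet _ (by positivity)]
    apply ENNReal.ofReal_le_ofReal
    simp only [qr]
    gcongr

lemma measurableSet_qcube {n : ℕ} (i : QIdx n) : MeasurableSet (qcube i) := measurableSet_cubeSet _ _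

/-- Maximal operator with respect to the measure `μ` over the countable family of cubes. -/
def hmax {n : ℕ} (μ : Measure (Eucl n)) (f : Eucl n → ℝ≥0∞) (x : Eucl n) : ℝ≥0∞ :=
  ⨆ i : QIdx n, (qcube i).indicator (fun _ => (μ (qcube i))⁻¹ * ∫⁻ y in qcube i, f y ∂μ) x

lemma measurable_hmax {n : ℕ} (μ : Measure (Eucl n)) (f : Eucl n → ℝ≥0∞) : Measurable (hmax μ f) :=
  Measurable.iSup fun i => measurable_const.indicator (measurableSet_qcube i)

lemma le_hmax {n : ℕ} (μ : Measure (Eucl n)) (f : Eucl n → ℝ≥0∞) (i : QIdx n) {x : Eucl n}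
    (hx : x ∈ qcube i) : (μ (qcube i))⁻¹ * ∫⁻ y in qcube i, f y ∂μ ≤ hmax μ f x := by
  refine le_trans ?_ (le_iSup _ i)
  rw [Set.indicator_of_mem hx]

lemma hmax_le {n : ℕ} (μ : Measure (Eucl n)) (f : Eucl n → ℝ≥0∞) {x : Eucl n} {c : ℝ≥0∞}
    (h : ∀ i, x ∈ qcube i → (μ (qcube i))⁻¹ * ∫⁻ y in qcube i, f y ∂μ ≤ c) : hmax μ f x ≤ c := by
  refine iSup_le fun i => ?_
  by_cases hx : x ∈ qcube i
  · rw [Set.indicator_of_mem hx]; exact h i hx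
  · rw [Set.indicator_of_notMem hx]; exact zero_le

/-- weak type bound, doubling measures -/
lemma hmax_weak {n : ℕ} (μ : Measure (Eucl n)) (D : ℝ≥0∞)
    (hD : ∀ (x : Eucl n) (r : ℝ), 0 < r → μ (cubeSet x (5 * r)) ≤ D * μ (cubeSet x r))
    (f : Eucl n → ℝ≥0∞) (t : ℝ≥0∞) :
    t * μ {x | t < hmax μ f x} ≤ D * ∫⁻ x, f x ∂μ := by
  classical
  set S : Set (QIdx n) := {i | t < (μ (qcube i))⁻¹ * ∫⁻ y in qcube i, f y ∂μ} with hS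
  have hset : {x | t < hmax μ f x} = ⋃ s : Finset (QIdx n), ⋃ i ∈ (s : Set (QIdx n)) ∩ S, qcube i := by
    ext x
    simp only [Set.mem_ofPred_eq, Set.mem_iUnion, hmax, lt_iSup_iff]
    constructor
    · rintro ⟨i, hi⟩
      by_cases hx : x ∈ qcube i
      · rw [Set.indicator_of_mem hx] at hi
        exact ⟨{i}, i, ⟨by simp, hi⟩, hx⟩
      · rw [Set.indicator_of_notMem hx] at hi
        exact absurd hi (by simp)
    · rintro ⟨s, i, hi, hx⟩
      refine ⟨i, ?_⟩
      rw [Set.indicator_of_mem hx]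
      exact hi.2
  have hdir : Directed (· ⊆ ·) (fun s : Finset (QIdx n) => ⋃ i ∈ (s : Set (QIdx n)) ∩ S, qcube i) := by
    refine Monotone.directed_le (f := fun s : Finset (QIdx n) => ⋃ i ∈ (s : Set (QIdx n)) ∩ S, qcube i) ?_
    intro s s' hss
    exact Set.biUnion_subset_biUnion_left (Set.inter_subset_inter_left _ (by exact_mod_cast hss))
  rw [hset, hdir.measure_iUnion, ENNReal.mul_iSup]
  refine iSup_le fun s => ?_
  obtain ⟨u, hut, hdisj, hcov⟩ := Vitali.exists_disjoint_subfamily_covering_enlargement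
    (fun i : QIdx n => qcube i) ((s : Set (QIdx n)) ∩ S) qr 2 (by norm_num) (fun i _ => (qr_pos i).le)
    (∑ i ∈ s, qr i) (fun i hi => Finset.single_le_sum (f := qr) (fun j _ => (qr_pos j).le) hi.1)
    (fun i _ => ⟨qc i, mem_cubeSet_self _ (qr_pos i).le⟩)
  have hufin : u.Finite := (s.finite_toSet.subset Set.inter_subset_left).subset hut
  have hsub : (⋃ i ∈ (s : Set (QIdx n)) ∩ S, qcube i) ⊆ ⋃ j ∈ u, cubeSet (qc j) (5 * qr j) := by
    intro x hx
    simp only [Set.mem_iUnion] at hx ⊢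
    obtain ⟨i, hi, hx⟩ := hx
    obtain ⟨j, hj, hne, hle⟩ := hcov i hi
    exact ⟨j, hj, cubeSet_subset_of_inter _ _ hne hle hx⟩
  have hcount : u.Countable := hufin.countable
  calc t * μ (⋃ i ∈ (s : Set (QIdx n)) ∩ S, qcube i)
      ≤ t * μ (⋃ j ∈ u, cubeSet (qc j) (5 * qr j)) := by gcongr
    _ ≤ t * ∑' j : u, μ (cubeSet (qc j.1) (5 * qr j.1)) := by
        gcongr
        exact measure_biUnion_le μ hcount _
    _ = ∑' j : u, t * μ (cubeSet (qc j.1) (5 * qr j.1)) := ENNReal.tsum_mul_left.symm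
    _ ≤ ∑' j : u, D * ∫⁻ y in qcube j.1, f y ∂μ := by
        refine ENNReal.tsum_le_tsum fun j => ?_
        have h1 : t < (μ (qcube j.1))⁻¹ * ∫⁻ y in qcube j.1, f y ∂μ := (hut j.2).2
        have h2 : t * μ (qcube j.1) ≤ ∫⁻ y in qcube j.1, f y ∂μ := by
          calc t * μ (qcube j.1) ≤ ((μ (qcube j.1))⁻¹ * ∫⁻ y in qcube j.1, f y ∂μ) * μ (qcube j.1) := by
                gcongr
            _ = ((μ (qcube j.1))⁻¹ * μ (qcube j.1)) * ∫⁻ y in qcube j.1, f y ∂μ := by ring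
            _ ≤ 1 * ∫⁻ y in qcube j.1, f y ∂μ := by
                gcongr
                exact ENNReal.inv_mul_le_one _
            _ = _ := one_mul _
        calc t * μ (cubeSet (qc j.1) (5 * qr j.1)) ≤ t * (D * μ (qcube j.1)) := by
              gcongr
              exact hD _ _ (qr_pos _)
          _ = D * (t * μ (qcube j.1)) := by ring
          _ ≤ _ := by gcongr
    _ = D * ∑' j : u, ∫⁻ y in qcube j.1, f y ∂μ := ENNReal.tsum_mul_left
    _ = D * ∫⁻ y in ⋃ j ∈ u, qcube j, f y ∂μ := by
        rw [lintegral_biUnion hcount (fun j _ => measurableSet_qcube j) hdisj]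
    _ ≤ D * ∫⁻ x, f x ∂μ := by
        gcongr
        exact Measure.restrict_le_self


/-! ### Dyadic sums -/

lemma two_rpow_ne_zero (x : ℝ) : (2 : ℝ≥0∞) ^ x ≠ 0 := (ENNReal.rpow_pos (by norm_num) (by norm_num)).ne'
lemma two_rpow_ne_top (x : ℝ) : (2 : ℝ≥0∞) ^ x ≠ ⊤ := ENNReal.rpow_ne_top_of_ne_zero (by norm_num) (by norm_num)
lemma two_rpow_add (x y : ℝ) : (2 : ℝ≥0∞) ^ (x + y) = 2 ^ x * 2 ^ y :=
  ENNReal.rpow_add _ _ (by norm_num) (by norm_num)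
lemma two_rpow_mono {x y : ℝ} (h : x ≤ y) : (2 : ℝ≥0∞) ^ x ≤ 2 ^ y :=
  ENNReal.rpow_le_rpow_of_exponent_le (by norm_num) h

def dySum (c : ℝ) : ℝ≥0∞ := ∑' j : ℤ, (2 : ℝ≥0∞) ^ (-(c * |(j : ℝ)|))

lemma dySum_nat_ne_top {c : ℝ} (hc : 0 < c) : ∑' j : ℕ, (2 : ℝ≥0∞) ^ (-(c * (j : ℝ))) ≠ ⊤ := by
  have h : ∀ j : ℕ, (2 : ℝ≥0∞) ^ (-(c * (j : ℝ))) = ((2 : ℝ≥0∞) ^ (-c)) ^ j := by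
    intro j
    rw [← ENNReal.rpow_natCast, ← ENNReal.rpow_mul]
    congr 1; ring
  simp_rw [h]
  rw [ENNReal.tsum_geometric]
  have : (2 : ℝ≥0∞) ^ (-c) < 1 := ENNReal.rpow_lt_one_of_one_lt_of_neg (by norm_num) (by linarith)
  simp only [ne_eq, ENNReal.inv_eq_top]
  exact (tsub_pos_of_lt this).ne'

lemma dySum_ne_top {c : ℝ} (hc : 0 < c) : dySum c ≠ ⊤ := by
  unfold dySum
  have hs : HasSum (fun j : ℤ => (2 : ℝ≥0∞) ^ (-(c * |(j : ℝ)|)))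
      ((∑' j : ℕ, (2 : ℝ≥0∞) ^ (-(c * |((j : ℤ) : ℝ)|))) + ∑' j : ℕ, (2 : ℝ≥0∞) ^ (-(c * |((-((j : ℤ) + 1) : ℤ) : ℝ)|))) :=
    HasSum.of_nat_of_neg_add_one (f := fun j : ℤ => (2 : ℝ≥0∞) ^ (-(c * |(j : ℝ)|)))
      ENNReal.summable.hasSum ENNReal.summable.hasSum
  rw [hs.tsum_eq]
  refine ENNReal.add_ne_top.2 ⟨?_, ?_⟩
  · simpa using dySum_nat_ne_top hc
  · refine ne_top_of_le_ne_top (dySum_nat_ne_top hc) (ENNReal.tsum_le_tsum fun j => ?_)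
    apply two_rpow_mono
    have : |((-((j : ℤ) + 1) : ℤ) : ℝ)| = (j : ℝ) + 1 := by
      push_cast
      rw [abs_neg, abs_of_nonneg (by positivity)]
    rw [this]
    nlinarith

lemma dySum_ne_zero (c : ℝ) : dySum c ≠ 0 := by
  intro h
  have := ENNReal.tsum_eq_zero.1 h 0
  exact two_rpow_ne_zero _ this

lemma exists_dyadic {s : ℝ≥0∞} (h0 : s ≠ 0) (ht : s ≠ ⊤) :
    ∃ k : ℤ, (2 : ℝ≥0∞) ^ (k : ℝ) < s ∧ s ≤ 2 ^ ((k : ℝ) + 1) := by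
  obtain ⟨k, h1, h2⟩ := ENNReal.exists_mem_Ioc_zpow (x := s) (y := 2) h0 ht (by norm_num) (by norm_num)
  refine ⟨k, ?_, ?_⟩
  · rwa [ENNReal.rpow_intCast]
  · rw [← ENNReal.rpow_intCast] at h2
    simpa using h2

lemma dyadic_lower {r : ℝ} (hr : 0 < r) (t : ℝ≥0∞) :
    t ^ r ≤ 2 ^ r * ∑' k : ℤ, (if (2 : ℝ≥0∞) ^ (k : ℝ) < t then (2 : ℝ≥0∞) ^ ((k : ℝ) * r) else 0) := by
  classical
  by_cases h0 : t = 0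
  · simp [h0, hr]
  by_cases ht : t = ⊤
  · have : (∑' k : ℤ, (if (2 : ℝ≥0∞) ^ (k : ℝ) < t then (2 : ℝ≥0∞) ^ ((k : ℝ) * r) else 0)) = ⊤ := by
      rw [eq_top_iff]
      calc ⊤ = ∑' _ : ℕ, (1 : ℝ≥0∞) := (ENNReal.tsum_const_eq_top_of_ne_zero one_ne_zero).symm
        _ ≤ ∑' k : ℕ, (if (2 : ℝ≥0∞) ^ (((k : ℕ) : ℤ) : ℝ) < t then (2 : ℝ≥0∞) ^ ((((k : ℕ) : ℤ) : ℝ) * r) else 0) := by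
            refine ENNReal.tsum_le_tsum fun k => ?_
            rw [if_pos (by rw [ht]; exact lt_top_iff_ne_top.2 (two_rpow_ne_top _))]
            rw [← ENNReal.rpow_zero (x := 2)]
            apply two_rpow_mono
            push_cast; positivity
        _ ≤ _ := ENNReal.tsum_comp_le_tsum_of_injective (f := fun k : ℕ => (k : ℤ)) (fun a b h => by simpa using h) _
    rw [this, ENNReal.mul_top (two_rpow_ne_zero _)]
    exact le_top
  obtain ⟨k, h1, h2⟩ := exists_dyadic h0 ht
  calc t ^ r ≤ (2 ^ ((k : ℝ) + 1)) ^ r := ENNReal.rpow_le_rpow h2 hr.le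
    _ = 2 ^ r * 2 ^ ((k : ℝ) * r) := by
        rw [← ENNReal.rpow_mul, ← two_rpow_add]; congr 1; ring
    _ ≤ _ := by
        gcongr
        refine le_trans ?_ (ENNReal.le_tsum k)
        rw [if_pos h1]

lemma dyadic_upper {c : ℝ} (hc : 0 < c) (s : ℝ≥0∞) :
    ∑' k : ℤ, (if (2 : ℝ≥0∞) ^ (k : ℝ) < s then (2 : ℝ≥0∞) ^ ((k : ℝ) * c) else 0) ≤ dySum c * s ^ c := by
  classical
  by_cases h0 : s = 0
  · simp [h0]
  by_cases ht : s = ⊤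
  · rw [ht, ENNReal.top_rpow_of_pos hc, ENNReal.mul_top (dySum_ne_zero c)]
    exact le_top
  obtain ⟨K, h1, h2⟩ := exists_dyadic h0 ht
  calc _ ≤ ∑' k : ℤ, (2 : ℝ≥0∞) ^ (-(c * |((K - k : ℤ) : ℝ)|)) * s ^ c := by
        refine ENNReal.tsum_le_tsum fun k => ?_
        split_ifs with h
        · have hk : k ≤ K := by
            by_contra hcon
            have : (K : ℝ) + 1 ≤ k := by exact_mod_cast (by omega : K + 1 ≤ k)
            exact absurd (h.trans_le h2) (not_lt.2 (two_rpow_mono this))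
          calc (2 : ℝ≥0∞) ^ ((k : ℝ) * c) = (2 : ℝ≥0∞) ^ (-(c * |((K - k : ℤ) : ℝ)|)) * (2 ^ (K : ℝ)) ^ c := by
                rw [← ENNReal.rpow_mul, ← two_rpow_add]
                congr 1
                have : (0 : ℝ) ≤ ((K - k : ℤ) : ℝ) := by exact_mod_cast (by omega : 0 ≤ K - k)
                rw [abs_of_nonneg this]
                push_cast; ring
            _ ≤ _ := by
                gcongr
        · exact zero_le
    _ = (∑' k : ℤ, (2 : ℝ≥0∞) ^ (-(c * |((K - k : ℤ) : ℝ)|))) * s ^ c := ENNReal.tsum_mul_right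
    _ = dySum c * s ^ c := by
        congr 1
        exact (Equiv.subLeft K).tsum_eq (fun j : ℤ => (2 : ℝ≥0∞) ^ (-(c * |(j : ℝ)|)))

/-! ### Strong type bound -/

lemma hmax_add_const {n : ℕ} (μ : Measure (Eucl n)) (f g : Eucl n → ℝ≥0∞) (c : ℝ≥0∞)
    (hfg : ∀ x, f x ≤ g x + c) (x : Eucl n) : hmax μ f x ≤ hmax μ g x + c := by
  refine hmax_le μ f fun i hi => ?_
  calc (μ (qcube i))⁻¹ * ∫⁻ y in qcube i, f y ∂μ
      ≤ (μ (qcube i))⁻¹ * ∫⁻ y in qcube i, (g y + c) ∂μ := by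
        gcongr with y; exact hfg y
    _ = (μ (qcube i))⁻¹ * (∫⁻ y in qcube i, g y ∂μ) + ((μ (qcube i))⁻¹ * μ (qcube i)) * c := by
        rw [lintegral_add_right _ measurable_const]
        simp only [lintegral_const, Measure.restrict_apply_univ]
        ring
    _ ≤ hmax μ g x + 1 * c := by
        gcongr
        · exact le_hmax μ g i hi
        · exact ENNReal.inv_mul_le_one _
    _ = _ := by rw [one_mul]

lemma hmax_weak' {n : ℕ} (μ : Measure (Eucl n)) (D : ℝ≥0∞)
    (hD : ∀ (x : Eucl n) (r : ℝ), 0 < r → μ (cubeSet x (5 * r)) ≤ D * μ (cubeSet x r))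
    (f : Eucl n → ℝ≥0∞) (t : ℝ≥0∞) (ht : t ≠ ⊤) :
    t * μ {x | t < hmax μ f x} ≤ 2 * D * ∫⁻ x, (if t < 2 * f x then f x else 0) ∂μ := by
  classical
  set g : Eucl n → ℝ≥0∞ := fun x => if t < 2 * f x then f x else 0
  have hfg : ∀ x, f x ≤ g x + t / 2 := by
    intro x
    simp only [g]
    split_ifs with h
    · exact le_self_add
    · rw [zero_add, ENNReal.le_div_iff_mul_le (by simp) (by simp), mul_comm]
      exact not_lt.1 h
  have hsub : {x | t < hmax μ f x} ⊆ {x | t / 2 < hmax μ g x} := by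
    intro x hx
    simp only [Set.mem_ofPred_eq] at hx ⊢
    have h1 := hx.trans_le (hmax_add_const μ f g (t / 2) hfg x)
    by_contra hcon
    have h2 : hmax μ g x + t / 2 ≤ t / 2 + t / 2 := by gcongr; exact not_lt.1 hcon
    rw [ENNReal.add_halves] at h2
    exact absurd h1 (not_lt.2 h2)
  calc t * μ {x | t < hmax μ f x} ≤ t * μ {x | t / 2 < hmax μ g x} := by gcongr
    _ = 2 * (t / 2 * μ {x | t / 2 < hmax μ g x}) := by
        rw [← mul_assoc, ENNReal.mul_div_cancel (by simp) (by simp)]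
    _ ≤ 2 * (D * ∫⁻ x, g x ∂μ) := mul_le_mul_right (hmax_weak μ D hD g (t / 2)) 2
    _ = _ := by ring

lemma hmax_strong {n : ℕ} {r : ℝ} (hr : 1 < r) (μ : Measure (Eucl n)) (D : ℝ≥0∞)
    (hD : ∀ (x : Eucl n) (r : ℝ), 0 < r → μ (cubeSet x (5 * r)) ≤ D * μ (cubeSet x r))
    (f : Eucl n → ℝ≥0∞) (hf : Measurable f) :
    ∫⁻ x, hmax μ f x ^ r ∂μ ≤ (2 ^ r * (2 * D) * dySum (r - 1) * 2 ^ (r - 1)) * ∫⁻ x, f x ^ r ∂μ := by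
  classical
  have hM := measurable_hmax μ f
  have hms : ∀ k : ℤ, MeasurableSet {x | (2 : ℝ≥0∞) ^ (k : ℝ) < hmax μ f x} := fun k =>
    measurableSet_lt measurable_const hM
  have hms2 : ∀ k : ℤ, MeasurableSet {x | (2 : ℝ≥0∞) ^ (k : ℝ) < 2 * f x} := fun k =>
    measurableSet_lt measurable_const (hf.const_mul 2)
  calc ∫⁻ x, hmax μ f x ^ r ∂μ
      ≤ ∫⁻ x, 2 ^ r * ∑' k : ℤ, (if (2 : ℝ≥0∞) ^ (k : ℝ) < hmax μ f x then (2 : ℝ≥0∞) ^ ((k : ℝ) * r) else 0) ∂μ :=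
        lintegral_mono fun x => dyadic_lower (by linarith) _
    _ = 2 ^ r * ∑' k : ℤ, ∫⁻ x, (if (2 : ℝ≥0∞) ^ (k : ℝ) < hmax μ f x then (2 : ℝ≥0∞) ^ ((k : ℝ) * r) else 0) ∂μ := by
        rw [lintegral_const_mul' _ _ (two_rpow_ne_top _), lintegral_tsum]
        intro k
        exact (Measurable.ite (hms k) measurable_const measurable_const).aemeasurable
    _ = 2 ^ r * ∑' k : ℤ, (2 : ℝ≥0∞) ^ ((k : ℝ) * (r - 1)) * (2 ^ (k : ℝ) * μ {x | (2 : ℝ≥0∞) ^ (k : ℝ) < hmax μ f x}) := by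
        congr 1
        refine tsum_congr fun k => ?_
        have : (fun x => if (2 : ℝ≥0∞) ^ (k : ℝ) < hmax μ f x then (2 : ℝ≥0∞) ^ ((k : ℝ) * r) else 0) =
          Set.indicator {x | (2 : ℝ≥0∞) ^ (k : ℝ) < hmax μ f x} (fun _ => (2 : ℝ≥0∞) ^ ((k : ℝ) * r)) := by
          ext x; simp [Set.indicator_apply]
        rw [this, lintegral_indicator_const (hms k), ← mul_assoc, ← two_rpow_add]
        congr 2; ring
    _ ≤ 2 ^ r * ∑' k : ℤ, (2 : ℝ≥0∞) ^ ((k : ℝ) * (r - 1)) *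
          (2 * D * ∫⁻ x, (if (2 : ℝ≥0∞) ^ (k : ℝ) < 2 * f x then f x else 0) ∂μ) := by
        refine mul_le_mul_right (ENNReal.tsum_le_tsum fun k => ?_) _
        exact mul_le_mul_right (hmax_weak' μ D hD f _ (two_rpow_ne_top _)) _
    _ = 2 ^ r * (2 * D) * ∑' k : ℤ, ∫⁻ x, (2 : ℝ≥0∞) ^ ((k : ℝ) * (r - 1)) *
            (if (2 : ℝ≥0∞) ^ (k : ℝ) < 2 * f x then f x else 0) ∂μ := by
        rw [mul_assoc]
        congr 1
        rw [← ENNReal.tsum_mul_left]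
        refine tsum_congr fun k => ?_
        rw [lintegral_const_mul' _ _ (two_rpow_ne_top _)]
        ring
    _ = 2 ^ r * (2 * D) * ∫⁻ x, f x * ∑' k : ℤ,
            (if (2 : ℝ≥0∞) ^ (k : ℝ) < 2 * f x then (2 : ℝ≥0∞) ^ ((k : ℝ) * (r - 1)) else 0) ∂μ := by
        rw [← lintegral_tsum]
        · congr 1
          refine lintegral_congr fun x => ?_
          rw [← ENNReal.tsum_mul_left]
          refine tsum_congr fun k => ?_
          split_ifs
          · ring
          · simp
        · intro k
          exact ((Measurable.ite (hms2 k) hf measurable_const).const_mul _).aemeasurable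
    _ ≤ 2 ^ r * (2 * D) * ∫⁻ x, f x * (dySum (r - 1) * (2 * f x) ^ (r - 1)) ∂μ := by
        gcongr with x
        exact dyadic_upper (by linarith) _
    _ = 2 ^ r * (2 * D) * ∫⁻ x, (dySum (r - 1) * 2 ^ (r - 1)) * f x ^ r ∂μ := by
        congr 1
        refine lintegral_congr fun x => ?_
        rw [ENNReal.mul_rpow_of_nonneg _ _ (by linarith)]
        have : f x ^ r = f x * f x ^ (r - 1) := by
          conv_rhs => rw [← ENNReal.rpow_one (f x), ← ENNReal.rpow_mul, one_mul]
          rw [← ENNReal.rpow_add_of_nonneg _ _ (by norm_num) (by linarith)]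
          congr 1; ring
        rw [this]; ring
    _ = _ := by
        rw [lintegral_const_mul' _ _ (ENNReal.mul_ne_top (dySum_ne_top (by linarith)) (two_rpow_ne_top _))]
        ring


/-! ### Basic facts on `A_p` weights -/

lemma rpow_self_mul {x : ℝ≥0∞} {p : ℝ} (hp : 1 ≤ p) : x * x ^ (p - 1) = x ^ p := by
  conv_lhs => rw [← ENNReal.rpow_one x, ← ENNReal.rpow_mul, one_mul]
  rw [← ENNReal.rpow_add_of_nonneg _ _ (by norm_num) (by linarith)]
  congr 1; ring

lemma weight_holder {n : ℕ} {w : Eucl n → ℝ≥0∞} (hw : IsWeight w) {p : ℝ} (hp : 1 < p)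
    (Q : Set (Eucl n)) :
    volume Q ^ p ≤ (∫⁻ y in Q, w y) * (∫⁻ y in Q, w y ^ (-(1/(p-1)))) ^ (p-1) := by
  have hp0 : 0 < p := by linarith
  have hp1 : 0 < p - 1 := by linarith
  have hconj := Real.HolderConjugate.conjExponent hp
  have h := ENNReal.lintegral_mul_le_Lp_mul_Lq (volume.restrict Q) hconj
    (f := fun y => w y ^ (1 / p)) (g := fun y => w y ^ (-(1 / p)))
    (hw.1.pow_const _).aemeasurable (hw.1.pow_const _).aemeasurable
  have h1 : ∫⁻ y in Q, ((fun y => w y ^ (1 / p)) * (fun y => w y ^ (-(1 / p)))) y = volume Q := by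
    rw [← setLIntegral_one]
    apply lintegral_congr_ae
    filter_upwards [ae_restrict_of_ae hw.2] with y hy
    rw [Pi.mul_apply, ← ENNReal.rpow_add _ _ hy.1.ne' hy.2.ne]
    simp
  have h2 : ∀ y, (w y ^ (1 / p)) ^ p = w y := fun y => by
    rw [← ENNReal.rpow_mul, one_div_mul_cancel hp0.ne', ENNReal.rpow_one]
  have h3 : ∀ y, (w y ^ (-(1 / p))) ^ p.conjExponent = w y ^ (-(1/(p-1))) := fun y => by
    rw [← ENNReal.rpow_mul]; congr 1
    unfold Real.conjExponent; field_simp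
  simp_rw [h1, h2, h3] at h
  calc volume Q ^ p ≤ ((∫⁻ y in Q, w y) ^ (1 / p) * (∫⁻ y in Q, w y ^ (-(1/(p-1)))) ^ (1 / p.conjExponent)) ^ p :=
        ENNReal.rpow_le_rpow h hp0.le
    _ = _ := by
        rw [ENNReal.mul_rpow_of_nonneg _ _ hp0.le, ← ENNReal.rpow_mul, ← ENNReal.rpow_mul,
          one_div_mul_cancel hp0.ne', ENNReal.rpow_one]
        congr 2
        unfold Real.conjExponent; field_simp

lemma ap_term {p : ℝ} (hp : 1 < p) (V W S : ℝ≥0∞) (hV0 : V ≠ 0) (hVt : V ≠ ⊤) :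
    W * S ^ (p - 1) = (V⁻¹ * W * (V⁻¹ * S) ^ (p - 1)) * V ^ p := by
  rw [ENNReal.mul_rpow_of_nonneg _ _ (by linarith), ← rpow_self_mul hp.le (x := V), ENNReal.inv_rpow]
  have h1 : V⁻¹ * V = 1 := ENNReal.inv_mul_cancel hV0 hVt
  have h2 : (V ^ (p-1))⁻¹ * V ^ (p-1) = 1 :=
    ENNReal.inv_mul_cancel (by simp [hV0, hVt]) (by simp [hV0, hVt])
  calc W * S ^ (p - 1) = (V⁻¹ * V) * ((V ^ (p-1))⁻¹ * V ^ (p-1)) * (W * S ^ (p - 1)) := by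
        rw [h1, h2]; simp
    _ = _ := by ring

lemma ap_cube {n : ℕ} {w : Eucl n → ℝ≥0∞} {p : ℝ} (hp : 1 < p) (x : Eucl n) {r : ℝ} (hr : 0 < r) :
    (∫⁻ y in cubeSet x r, w y) * (∫⁻ y in cubeSet x r, w y ^ (-(1/(p-1)))) ^ (p-1)
      ≤ apConst n p w * volume (cubeSet x r) ^ p := by
  rw [ap_term hp (volume (cubeSet x r)) _ _ (volume_cubeSet_ne_zero x hr) (volume_cubeSet_ne_top x hr)]
  gcongr
  unfold apConst
  exact le_iSup_of_le x (le_iSup_of_le r (le_iSup_of_le hr le_rfl))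

lemma one_le_apConst {n : ℕ} {w : Eucl n → ℝ≥0∞} (hw : IsWeight w) {p : ℝ} (hp : 1 < p) :
    1 ≤ apConst n p w := by
  have h := (weight_holder hw hp (cubeSet 0 1)).trans (ap_cube hp 0 one_pos)
  have h0 : volume (cubeSet (0 : Eucl n) 1) ^ p ≠ 0 := by
    simp [volume_cubeSet_ne_zero, volume_cubeSet_ne_top]
  have ht : volume (cubeSet (0 : Eucl n) 1) ^ p ≠ ⊤ := by
    simp [volume_cubeSet_ne_zero, volume_cubeSet_ne_top]
  rw [← one_mul (volume _ ^ p)] at h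
  exact (ENNReal.mul_le_mul_iff_left h0 ht).1 (by simpa using h)

lemma lintegral_cube_ne_zero {n : ℕ} {w : Eucl n → ℝ≥0∞} (hm : Measurable w)
    (hw : ∀ᵐ x ∂(volume : Measure (Eucl n)), 0 < w x) (x : Eucl n) {r : ℝ} (hr : 0 < r) :
    ∫⁻ y in cubeSet x r, w y ≠ 0 := by
  intro h
  rw [lintegral_eq_zero_iff hm] at h
  have h2 : ∀ᵐ y ∂(volume.restrict (cubeSet x r)), False := by
    filter_upwards [h, ae_restrict_of_ae hw] with y h1 h2
    exact h2.ne' h1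
  have h3 : volume.restrict (cubeSet x r) = 0 := by
    rw [← ae_eq_bot]
    exact Filter.eventually_false_iff_eq_bot.1 h2
  rw [Measure.restrict_eq_zero] at h3
  exact volume_cubeSet_ne_zero x hr h3

lemma IsWeight.dual {n : ℕ} {w : Eucl n → ℝ≥0∞} (hw : IsWeight w) (s : ℝ) :
    IsWeight (fun y => w y ^ s) := by
  refine ⟨hw.1.pow_const _, ?_⟩
  filter_upwards [hw.2] with y hy
  exact ⟨ENNReal.rpow_pos hy.1 hy.2.ne, lt_top_iff_ne_top.2 (ENNReal.rpow_ne_top_of_ne_zero hy.1.ne' hy.2.ne)⟩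

lemma IsWeight.int_ne_zero {n : ℕ} {w : Eucl n → ℝ≥0∞} (hw : IsWeight w) (x : Eucl n) {r : ℝ} (hr : 0 < r) :
    ∫⁻ y in cubeSet x r, w y ≠ 0 :=
  lintegral_cube_ne_zero hw.1 (hw.2.mono fun _ h => h.1) x hr

lemma apConst_dual {n : ℕ} {w : Eucl n → ℝ≥0∞} {p : ℝ} (hp : 1 < p) :
    apConst n (p / (p - 1)) (fun y => w y ^ (-(1/(p-1)))) ≤ apConst n p w ^ (1 / (p - 1)) := by
  have hp1 : 0 < p - 1 := by linarith
  have e1 : p / (p - 1) - 1 = 1 / (p - 1) := by field_simp; ring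
  conv_lhs => unfold apConst
  refine iSup_le fun x => iSup_le fun r => iSup_le fun hr => ?_
  rw [e1]
  have e2 : ∀ y, (w y ^ (-(1/(p-1)))) ^ (-(1/(1/(p-1)))) = w y := fun y => by
    rw [← ENNReal.rpow_mul]
    conv_rhs => rw [← ENNReal.rpow_one (w y)]
    congr 1; field_simp
  simp_rw [e2]
  have h : ((volume (cubeSet x r))⁻¹ * ∫⁻ y in cubeSet x r, w y) *
      ((volume (cubeSet x r))⁻¹ * ∫⁻ y in cubeSet x r, w y ^ (-(1/(p-1)))) ^ (p-1) ≤ apConst n p w :=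
    le_iSup_of_le x (le_iSup_of_le r (le_iSup_of_le hr le_rfl))
  refine le_trans (le_of_eq ?_) (ENNReal.rpow_le_rpow h (by positivity : 0 ≤ 1 / (p - 1)))
  conv_rhs => rw [ENNReal.mul_rpow_of_nonneg _ _ (by positivity), ← ENNReal.rpow_mul, mul_one_div_cancel hp1.ne',
    ENNReal.rpow_one, mul_comm]

lemma ap_int_ne_top {n : ℕ} {w : Eucl n → ℝ≥0∞} (hw : IsWeight w) {p : ℝ} (hp : 1 < p)
    (hK : apConst n p w ≠ ⊤) (x : Eucl n) {r : ℝ} (hr : 0 < r) :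
    ∫⁻ y in cubeSet x r, w y ≠ ⊤ := by
  intro h
  have h1 := ap_cube (w := w) hp x hr
  have h2 : (∫⁻ y in cubeSet x r, w y ^ (-(1/(p-1)))) ^ (p-1) ≠ 0 := by
    have := (hw.dual (-(1/(p-1)))).int_ne_zero x hr
    simp only [ne_eq, ENNReal.rpow_eq_zero_iff, not_or, not_and, not_lt]
    exact ⟨fun h => absurd h this, fun _ => by linarith⟩
  rw [h, ENNReal.top_mul h2, top_le_iff] at h1
  refine ENNReal.mul_ne_top hK ?_ h1
  exact ENNReal.rpow_ne_top_of_nonneg (by linarith) (volume_cubeSet_ne_top x hr)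

lemma ap_int_dual_ne_top {n : ℕ} {w : Eucl n → ℝ≥0∞} (hw : IsWeight w) {p : ℝ} (hp : 1 < p)
    (hK : apConst n p w ≠ ⊤) (x : Eucl n) {r : ℝ} (hr : 0 < r) :
    ∫⁻ y in cubeSet x r, w y ^ (-(1/(p-1))) ≠ ⊤ := by
  refine ap_int_ne_top (hw.dual _) (p := p / (p - 1)) ?_ ?_ x hr
  · rw [lt_div_iff₀ (by linarith)]; linarith
  · refine ne_top_of_le_ne_top ?_ (apConst_dual hp)
    exact ENNReal.rpow_ne_top_of_nonneg (by have : 0 < p - 1 := by linarith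
                                            positivity) hK

lemma ap_doubling {n : ℕ} {w : Eucl n → ℝ≥0∞} (hw : IsWeight w) {p : ℝ} (hp : 1 < p)
    (hK : apConst n p w ≠ ⊤) (x : Eucl n) {r : ℝ} (hr : 0 < r) :
    ∫⁻ y in cubeSet x (5 * r), w y ≤
      apConst n p w * ENNReal.ofReal (5 ^ n) ^ p * ∫⁻ y in cubeSet x r, w y := by
  have hr5 : 0 < 5 * r := by linarith
  have hp1 : 0 < p - 1 := by linarith
  set S5 := ∫⁻ y in cubeSet x (5 * r), w y ^ (-(1/(p-1)))
  have hS0 : S5 ^ (p-1) ≠ 0 := by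
    have : S5 ≠ 0 := (hw.dual (-(1/(p-1)))).int_ne_zero x hr5
    simp only [ne_eq, ENNReal.rpow_eq_zero_iff, not_or, not_and, not_lt]
    exact ⟨fun h => absurd h this, fun _ => by linarith⟩
  have hSt : S5 ^ (p-1) ≠ ⊤ := ENNReal.rpow_ne_top_of_nonneg hp1.le (ap_int_dual_ne_top hw hp hK x hr5)
  refine (ENNReal.mul_le_mul_iff_left hS0 hSt).1 ?_
  calc (∫⁻ y in cubeSet x (5 * r), w y) * S5 ^ (p-1)
      ≤ apConst n p w * volume (cubeSet x (5 * r)) ^ p := ap_cube hp x hr5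
    _ = apConst n p w * ENNReal.ofReal (5 ^ n) ^ p * volume (cubeSet x r) ^ p := by
        rw [volume_cubeSet_mul x x hr (by norm_num), ENNReal.mul_rpow_of_nonneg _ _ (by linarith), mul_assoc]
    _ ≤ apConst n p w * ENNReal.ofReal (5 ^ n) ^ p *
          ((∫⁻ y in cubeSet x r, w y) * (∫⁻ y in cubeSet x r, w y ^ (-(1/(p-1)))) ^ (p-1)) := by
        gcongr
        exact weight_holder hw hp _
    _ ≤ apConst n p w * ENNReal.ofReal (5 ^ n) ^ p * ((∫⁻ y in cubeSet x r, w y) * S5 ^ (p-1)) := by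
        gcongr
        refine lintegral_mono_set (cubeSet_mono x (by linarith))
    _ = _ := by ring

/-- weighted maximal inequality with respect to `w dx` -/
lemma hmax_weight_strong {n : ℕ} {w : Eucl n → ℝ≥0∞} (hw : IsWeight w) {p : ℝ} (hp : 1 < p)
    (hK : apConst n p w ≠ ⊤) {r : ℝ} (hr : 1 < r) (f : Eucl n → ℝ≥0∞) (hf : Measurable f) :
    ∫⁻ x, hmax (volume.withDensity w) f x ^ r * w x ≤
      (2 ^ r * (2 * (apConst n p w * ENNReal.ofReal (5 ^ n) ^ p)) * dySum (r - 1) * 2 ^ (r - 1)) *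
        ∫⁻ x, f x ^ r * w x := by
  have h := hmax_strong hr (volume.withDensity w) (apConst n p w * ENNReal.ofReal (5 ^ n) ^ p) ?_ f hf
  · rw [lintegral_withDensity_eq_lintegral_mul _ hw.1 ((measurable_hmax _ _).pow_const _),
      lintegral_withDensity_eq_lintegral_mul _ hw.1 (hf.pow_const _)] at h
    simp only [Pi.mul_apply] at h
    simp_rw [mul_comm _ (w _)]
    exact h
  · intro x ρ hρ
    rw [withDensity_apply _ (measurableSet_cubeSet _ _), withDensity_apply _ (measurableSet_cubeSet _ _)]
    exact ap_doubling hw hp hK x hρ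


/-- pointwise bound (Lerner's argument). -/
lemma hmax_pointwise {n : ℕ} {w : Eucl n → ℝ≥0∞} (hw : IsWeight w) {r : ℝ} (hr : 1 < r)
    (hK : apConst n r w ≠ ⊤) (f : Eucl n → ℝ≥0∞) (hf : Measurable f) (x : Eucl n) :
    hmax volume f x ≤ (apConst n r w * hmax (volume.withDensity w)
      (fun y => hmax (volume.withDensity (fun z => w z ^ (-(1/(r-1)))))
        (fun z => f z * w z ^ (1/(r-1))) y ^ (r-1) * (w y)⁻¹) x) ^ (1 / (r-1)) := by
  have hr1 : 0 < r - 1 := by linarith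
  set s := 1 / (r - 1) with hs
  set σ : Eucl n → ℝ≥0∞ := fun z => w z ^ (-s) with hσ
  have hσw : IsWeight σ := hw.dual _
  set G := hmax (volume.withDensity σ) (fun z => f z * w z ^ s) with hG
  have hGm : Measurable G := measurable_hmax _ _
  set g : Eucl n → ℝ≥0∞ := fun y => G y ^ (r-1) * (w y)⁻¹ with hg
  have hgm : Measurable g := (hGm.pow_const _).mul hw.1.inv
  refine hmax_le _ _ fun i hi => ?_
  have hV0 : volume (qcube i) ≠ 0 := volume_cubeSet_ne_zero _ (qr_pos i)
  have hVt : volume (qcube i) ≠ ⊤ := volume_cubeSet_ne_top _ (qr_pos i)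
  have hW0 : ∫⁻ y in qcube i, w y ≠ 0 := hw.int_ne_zero _ (qr_pos i)
  have hWt : ∫⁻ y in qcube i, w y ≠ ⊤ := ap_int_ne_top hw hr hK _ (qr_pos i)
  have hS0 : ∫⁻ y in qcube i, σ y ≠ 0 := hσw.int_ne_zero _ (qr_pos i)
  have hSt : ∫⁻ y in qcube i, σ y ≠ ⊤ := ap_int_dual_ne_top hw hr hK _ (qr_pos i)
  have hap : (∫⁻ y in qcube i, w y) * (∫⁻ y in qcube i, σ y) ^ (r-1) ≤ apConst n r w * volume (qcube i) ^ r :=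
    ap_cube hr _ (qr_pos i)
  set V := volume (qcube i)
  set W := ∫⁻ y in qcube i, w y
  set S := ∫⁻ y in qcube i, σ y
  set I := ∫⁻ y in qcube i, f y
  have hfm : Measurable (fun z => f z * w z ^ s) := hf.mul (hw.1.pow_const _)
  have hInt : ∫⁻ y in qcube i, f y * w y ^ s ∂(volume.withDensity σ) = I := by
    rw [restrict_withDensity (measurableSet_qcube i),
      lintegral_withDensity_eq_lintegral_mul _ hσw.1 hfm]
    apply lintegral_congr_ae
    filter_upwards [ae_restrict_of_ae hw.2] with y hy
    simp only [Pi.mul_apply, hσ]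
    rw [mul_left_comm, ← ENNReal.rpow_add _ _ hy.1.ne' hy.2.ne]
    simp
  have h1 : ∀ y ∈ qcube i, S⁻¹ * I ≤ G y := by
    intro y hy
    have := le_hmax (volume.withDensity σ) (fun z => f z * w z ^ s) i hy
    rwa [hInt, withDensity_apply _ (measurableSet_qcube i)] at this
  have h2 : (S⁻¹ * I) ^ (r-1) * V ≤ ∫⁻ y in qcube i, g y ∂(volume.withDensity w) := by
    rw [restrict_withDensity (measurableSet_qcube i),
      lintegral_withDensity_eq_lintegral_mul _ hw.1 hgm]
    calc (S⁻¹ * I) ^ (r-1) * V = ∫⁻ y in qcube i, (S⁻¹ * I) ^ (r-1) := by simp [V]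
      _ ≤ ∫⁻ y in qcube i, G y ^ (r-1) := by
          refine setLIntegral_mono (hGm.pow_const _) fun y hy => ?_
          exact ENNReal.rpow_le_rpow (h1 y hy) hr1.le
      _ = _ := by
          apply lintegral_congr_ae
          filter_upwards [ae_restrict_of_ae hw.2] with y hy
          simp only [Pi.mul_apply, hg]
          rw [mul_left_comm, ENNReal.mul_inv_cancel hy.1.ne' hy.2.ne, mul_one]
  have h3 : W⁻¹ * ((S⁻¹ * I) ^ (r-1) * V) ≤ hmax (volume.withDensity w) g x := by
    have := le_hmax (volume.withDensity w) g i hi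
    rw [withDensity_apply _ (measurableSet_qcube i)] at this
    exact le_trans (mul_le_mul_right h2 _) this
  have h4 : (V⁻¹ * I) ^ (r-1) ≤ apConst n r w * hmax (volume.withDensity w) g x := by
    refine le_trans ?_ (mul_le_mul_right h3 _)
    rw [ENNReal.mul_rpow_of_nonneg _ _ hr1.le, ENNReal.mul_rpow_of_nonneg _ _ hr1.le, ENNReal.inv_rpow,
      ENNReal.inv_rpow]
    rw [← rpow_self_mul hr.le] at hap
    have hVr0 : V ^ (r-1) ≠ 0 := by simp [hV0, hVt]
    have hVrt : V ^ (r-1) ≠ ⊤ := by simp [hV0, hVt]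
    have hSr0 : S ^ (r-1) ≠ 0 := by simp [hS0, hSt]
    have hSrt : S ^ (r-1) ≠ ⊤ := by simp [hS0, hSt]
    calc (V ^ (r-1))⁻¹ * I ^ (r-1)
        = (V ^ (r-1))⁻¹ * (W⁻¹ * (S ^ (r-1))⁻¹ * (W * S ^ (r-1))) * I ^ (r-1) := by
          have : W⁻¹ * (S ^ (r-1))⁻¹ * (W * S ^ (r-1)) = 1 := by
            calc _ = (W⁻¹ * W) * ((S ^ (r-1))⁻¹ * S ^ (r-1)) := by ring
              _ = 1 := by rw [ENNReal.inv_mul_cancel hW0 hWt, ENNReal.inv_mul_cancel hSr0 hSrt, one_mul]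
          rw [this, mul_one]
      _ ≤ (V ^ (r-1))⁻¹ * (W⁻¹ * (S ^ (r-1))⁻¹ * (apConst n r w * (V * V ^ (r-1)))) * I ^ (r-1) := by
          gcongr
      _ = ((V ^ (r-1))⁻¹ * V ^ (r-1)) * (apConst n r w * (W⁻¹ * ((S ^ (r-1))⁻¹ * I ^ (r-1) * V))) := by ring
      _ = _ := by rw [ENNReal.inv_mul_cancel hVr0 hVrt, one_mul]
  calc V⁻¹ * I = ((V⁻¹ * I) ^ (r-1)) ^ s := by
        rw [← ENNReal.rpow_mul, hs, mul_one_div_cancel hr1.ne', ENNReal.rpow_one]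
    _ ≤ _ := ENNReal.rpow_le_rpow h4 (by positivity)

/-- Muckenhoupt's theorem. -/
theorem muckenhoupt (n : ℕ) {r : ℝ} (hr : 1 < r) {K : ℝ≥0∞} (hK : K ≠ ⊤) :
    ∃ C : ℝ≥0∞, C ≠ ⊤ ∧ ∀ w : Eucl n → ℝ≥0∞, IsWeight w → apConst n r w ≤ K →
      ∀ f : Eucl n → ℝ≥0∞, Measurable f →
        ∫⁻ x, hmax volume f x ^ r * w x ≤ C * ∫⁻ x, f x ^ r * w x := by
  have hr1 : 0 < r - 1 := by linarith
  set r' := r / (r - 1) with hr'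
  have hr'1 : 1 < r' := by rw [hr', lt_div_iff₀ hr1]; linarith
  have er' : r' - 1 = 1 / (r - 1) := by rw [hr']; field_simp; ring
  set C1 : ℝ≥0∞ := 2 ^ r' * (2 * (K * ENNReal.ofReal (5 ^ n) ^ r)) * dySum (r' - 1) * 2 ^ (r' - 1) with hC1
  set C2 : ℝ≥0∞ := 2 ^ r * (2 * (K ^ (1 / (r-1)) * ENNReal.ofReal (5 ^ n) ^ r')) * dySum (r - 1) * 2 ^ (r - 1) with hC2
  have hC1t : C1 ≠ ⊤ := by
    refine ENNReal.mul_ne_top (ENNReal.mul_ne_top (ENNReal.mul_ne_top (two_rpow_ne_top _) (ENNReal.mul_ne_top (by simp)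
      (ENNReal.mul_ne_top hK ?_))) (dySum_ne_top (by linarith))) (two_rpow_ne_top _)
    exact ENNReal.rpow_ne_top_of_nonneg (by linarith) ENNReal.ofReal_ne_top
  have hC2t : C2 ≠ ⊤ := by
    refine ENNReal.mul_ne_top (ENNReal.mul_ne_top (ENNReal.mul_ne_top (two_rpow_ne_top _) (ENNReal.mul_ne_top (by simp)
      (ENNReal.mul_ne_top ?_ ?_))) (dySum_ne_top (by linarith))) (two_rpow_ne_top _)
    · exact ENNReal.rpow_ne_top_of_nonneg (by positivity) hK
    exact ENNReal.rpow_ne_top_of_nonneg (by linarith) ENNReal.ofReal_ne_top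
  refine ⟨K ^ r' * (C1 * C2), ENNReal.mul_ne_top (ENNReal.rpow_ne_top_of_nonneg (by linarith) hK)
    (ENNReal.mul_ne_top hC1t hC2t), ?_⟩
  intro w hw hwK f hf
  have hKw : apConst n r w ≠ ⊤ := ne_top_of_le_ne_top hK hwK
  set s := 1 / (r - 1) with hs
  have hs0 : 0 < s := by positivity
  set σ : Eucl n → ℝ≥0∞ := fun z => w z ^ (-s) with hσ
  have hσw : IsWeight σ := hw.dual _
  have hσK : apConst n r' σ ≤ K ^ s := (apConst_dual hr).trans (ENNReal.rpow_le_rpow hwK hs0.le)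
  have hσKt : apConst n r' σ ≠ ⊤ := ne_top_of_le_ne_top (ENNReal.rpow_ne_top_of_nonneg hs0.le hK) hσK
  set G := hmax (volume.withDensity σ) (fun z => f z * w z ^ s) with hG
  have hGm : Measurable G := measurable_hmax _ _
  set g : Eucl n → ℝ≥0∞ := fun y => G y ^ (r-1) * (w y)⁻¹ with hg
  have hgm : Measurable g := (hGm.pow_const _).mul hw.1.inv
  set H := hmax (volume.withDensity w) g with hH
  have hsr : s * r = r' := by rw [hs, hr']; ring
  have step1 : ∫⁻ x, hmax volume f x ^ r * w x ≤ K ^ r' * ∫⁻ x, H x ^ r' * w x := by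
    rw [← lintegral_const_mul' _ _ (ENNReal.rpow_ne_top_of_nonneg (by linarith) hK)]
    refine lintegral_mono fun x => ?_
    calc hmax volume f x ^ r * w x ≤ ((apConst n r w * H x) ^ s) ^ r * w x := by
          gcongr
          exact hmax_pointwise hw hr hKw f hf x
      _ ≤ ((K * H x) ^ s) ^ r * w x := by gcongr
      _ = _ := by
          rw [← ENNReal.rpow_mul, hsr, ENNReal.mul_rpow_of_nonneg _ _ (by linarith), mul_assoc]
  have step2 : ∫⁻ x, H x ^ r' * w x ≤ C1 * ∫⁻ x, g x ^ r' * w x := by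
    refine (hmax_weight_strong hw hr hKw hr'1 g hgm).trans ?_
    rw [hC1]; gcongr
  have step3 : ∫⁻ x, g x ^ r' * w x = ∫⁻ x, G x ^ r * σ x := by
    apply lintegral_congr_ae
    filter_upwards [hw.2] with x hx
    simp only [hg, hσ]
    rw [ENNReal.mul_rpow_of_nonneg _ _ (by linarith), ← ENNReal.rpow_mul, ← ENNReal.rpow_neg_one, ← ENNReal.rpow_mul,
      mul_assoc]
    congr 1
    · congr 1; rw [hr']; field_simp
    · conv_lhs => enter [2]; rw [← ENNReal.rpow_one (w x)]
      rw [← ENNReal.rpow_add _ _ hx.1.ne' hx.2.ne]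
      congr 1; linarith
  have hfm : Measurable (fun z => f z * w z ^ s) := hf.mul (hw.1.pow_const _)
  have step4 : ∫⁻ x, G x ^ r * σ x ≤ C2 * ∫⁻ x, (f x * w x ^ s) ^ r * σ x := by
    refine (hmax_weight_strong hσw hr'1 hσKt hr (fun z => f z * w z ^ s) hfm).trans ?_
    rw [hC2]; gcongr
  have step5 : ∫⁻ x, (f x * w x ^ s) ^ r * σ x = ∫⁻ x, f x ^ r * w x := by
    apply lintegral_congr_ae
    filter_upwards [hw.2] with x hx
    simp only [hσ]
    rw [ENNReal.mul_rpow_of_nonneg _ _ (by linarith), ← ENNReal.rpow_mul, mul_assoc,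
      ← ENNReal.rpow_add _ _ hx.1.ne' hx.2.ne]
    congr 1
    conv_rhs => rw [← ENNReal.rpow_one (w x)]
    congr 1; rw [hs]; field_simp; ring
  calc _ ≤ K ^ r' * ∫⁻ x, H x ^ r' * w x := step1
    _ ≤ K ^ r' * (C1 * (C2 * ∫⁻ x, f x ^ r * w x)) := by
        refine mul_le_mul_right (step2.trans ?_) _
        rw [step3]
        refine mul_le_mul_right (step4.trans ?_) _
        rw [step5]
    _ = _ := by ring


/-! ### Rubio de Francia iteration -/

/-- `A_1` condition with constant `A`. -/
def IsA1 {n : ℕ} (A : ℝ≥0∞) (H : Eucl n → ℝ≥0∞) : Prop :=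
  ∀ (x : Eucl n) (r : ℝ), 0 < r → ∀ y ∈ cubeSet x r, ∫⁻ z in cubeSet x r, H z ≤ A * volume (cubeSet x r) * H y

lemma tsum_half : ∑' k : ℕ, (2⁻¹ : ℝ≥0∞) ^ k = 2 := by
  rw [ENNReal.tsum_geometric, ENNReal.one_sub_inv_two, inv_inv]

lemma pow_rpow_comm (d : ℝ≥0∞) (r : ℝ) (k : ℕ) : (d ^ k) ^ r = (d ^ r) ^ k := by
  rw [← ENNReal.rpow_natCast, ← ENNReal.rpow_natCast, ← ENNReal.rpow_mul, ← ENNReal.rpow_mul, mul_comm]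

lemma isA1_of_hmax {n : ℕ} {A : ℝ≥0∞} {H : Eucl n → ℝ≥0∞} (h : ∀ x, hmax volume H x ≤ A * H x) :
    IsA1 (ENNReal.ofReal (2 ^ n) * A) H := by
  intro x r hr y hy
  obtain ⟨i, hi, hV⟩ := exists_qcube x hr
  have h1 := (le_hmax volume H i (hi hy)).trans (h y)
  have hV0 : volume (qcube i) ≠ 0 := volume_cubeSet_ne_zero _ (qr_pos i)
  have hVt : volume (qcube i) ≠ ⊤ := volume_cubeSet_ne_top _ (qr_pos i)
  calc ∫⁻ z in cubeSet x r, H z ≤ ∫⁻ z in qcube i, H z := lintegral_mono_set hi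
    _ = volume (qcube i) * ((volume (qcube i))⁻¹ * ∫⁻ z in qcube i, H z) := by
        rw [← mul_assoc, ENNReal.mul_inv_cancel hV0 hVt, one_mul]
    _ ≤ (ENNReal.ofReal (2 ^ n) * volume (cubeSet x r)) * (A * H y) := mul_le_mul' hV h1
    _ = _ := by ring

lemma hmax_tsum_le {n : ℕ} (F : ℕ → Eucl n → ℝ≥0∞) (hF : ∀ k, Measurable (F k)) (c : ℕ → ℝ≥0∞) (x : Eucl n) :
    hmax volume (fun y => ∑' k, c k * F k y) x ≤ ∑' k, c k * hmax volume (F k) x := by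
  refine hmax_le _ _ fun i hi => ?_
  rw [lintegral_tsum (fun k => ((hF k).const_mul _).aemeasurable), ← ENNReal.tsum_mul_left]
  refine ENNReal.tsum_le_tsum fun k => ?_
  rw [lintegral_const_mul _ (hF k), mul_left_comm]
  exact mul_le_mul_right (le_hmax _ _ i hi) _

theorem rubio (n : ℕ) {r : ℝ} (hr : 1 < r) {K : ℝ≥0∞} (hK : K ≠ ⊤) :
    ∃ C A : ℝ≥0∞, C ≠ ⊤ ∧ A ≠ ⊤ ∧ ∀ w : Eucl n → ℝ≥0∞, IsWeight w → apConst n r w ≤ K →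
      ∀ h : Eucl n → ℝ≥0∞, Measurable h → ∃ H : Eucl n → ℝ≥0∞, Measurable H ∧ (∀ x, h x ≤ H x) ∧
        ∫⁻ x, H x ^ r * w x ≤ C * ∫⁻ x, h x ^ r * w x ∧ IsA1 A H := by
  obtain ⟨C, hC, hM⟩ := muckenhoupt n hr hK
  have hr0 : 0 < r := by linarith
  set d : ℝ≥0∞ := ((2 * (C + 1))⁻¹) ^ (1/r) with hd
  have hd0 : d ≠ 0 := by
    rw [hd]
    refine (ENNReal.rpow_pos (ENNReal.inv_pos.2 (ENNReal.mul_ne_top (by simp) (by simp [hC]))) ?_).ne'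
    simp
  have hdt : d ≠ ⊤ := by
    rw [hd]
    refine ENNReal.rpow_ne_top_of_nonneg (by positivity) ?_
    simp
  have hdr : d ^ r * C ≤ 2⁻¹ := by
    rw [hd, ← ENNReal.rpow_mul, one_div_mul_cancel hr0.ne', ENNReal.rpow_one,
      ENNReal.mul_inv (by simp) (by simp), mul_assoc]
    conv_rhs => rw [← mul_one (2⁻¹ : ℝ≥0∞)]
    refine mul_le_mul_right ?_ _
    calc (C + 1)⁻¹ * C ≤ (C+1)⁻¹ * (C+1) := by gcongr; exact le_self_add
      _ ≤ 1 := ENNReal.inv_mul_le_one _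
  set c : ℝ≥0∞ := 2⁻¹ * d with hc
  have hc0 : c ≠ 0 := by simp [hc, hd0]
  have hct : c ≠ ⊤ := ENNReal.mul_ne_top (by simp) hdt
  refine ⟨2 ^ r * 2, ENNReal.ofReal (2 ^ n) * c⁻¹, ENNReal.mul_ne_top (two_rpow_ne_top _) (by simp),
    ENNReal.mul_ne_top ENNReal.ofReal_ne_top (by simp [hc0]), ?_⟩
  intro w hw hwK h hh
  set F : ℕ → Eucl n → ℝ≥0∞ := fun k => (hmax volume)^[k] h with hFdef
  have hF0 : F 0 = h := rfl
  have hFs : ∀ k, F (k+1) = hmax volume (F k) := fun k => Function.iterate_succ_apply' _ _ _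
  have hFm : ∀ k, Measurable (F k) := by
    intro k
    cases k with
    | zero => exact hh
    | succ k => rw [hFs]; exact measurable_hmax _ _
  have hFI : ∀ k, ∫⁻ x, F k x ^ r * w x ≤ C ^ k * ∫⁻ x, h x ^ r * w x := by
    intro k
    induction k with
    | zero => simp [hF0]
    | succ k ih =>
      rw [hFs]
      refine (hM w hw hwK (F k) (hFm k)).trans ?_
      rw [pow_succ', mul_assoc]
      exact mul_le_mul_right ih _
  set H : Eucl n → ℝ≥0∞ := fun x => ∑' k, c ^ k * F k x with hH
  have hHm : Measurable H := Measurable.tsum fun k => (hFm k).const_mul _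
  refine ⟨H, hHm, ?_, ?_, ?_⟩
  · intro x
    refine le_trans ?_ (ENNReal.le_tsum 0)
    simp [hF0]
  · have hpt : ∀ x, H x ^ r ≤ 2 ^ r * ∑' k, (d ^ r) ^ k * F k x ^ r := by
      intro x
      have h1 : H x ≤ (⨆ k, d ^ k * F k x) * 2 := by
        rw [← tsum_half, ← ENNReal.tsum_mul_left]
        refine ENNReal.tsum_le_tsum fun k => ?_
        rw [hc, mul_pow, mul_comm _ ((2⁻¹ : ℝ≥0∞) ^ k), mul_assoc]
        exact mul_le_mul_right (le_iSup (fun k => d ^ k * F k x) k) _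
      have h2 : (⨆ k, d ^ k * F k x) ≤ (∑' k, (d ^ r) ^ k * F k x ^ r) ^ (1/r) := by
        refine iSup_le fun k => ?_
        rw [one_div, ENNReal.le_rpow_inv_iff hr0]
        refine le_trans (le_of_eq ?_) (ENNReal.le_tsum k)
        rw [ENNReal.mul_rpow_of_nonneg _ _ hr0.le]
        congr 1
        exact pow_rpow_comm _ _ _
      calc H x ^ r ≤ ((∑' k, (d ^ r) ^ k * F k x ^ r) ^ (1/r) * 2) ^ r := by
            refine ENNReal.rpow_le_rpow (h1.trans ?_) hr0.le
            gcongr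
        _ = _ := by
            rw [ENNReal.mul_rpow_of_nonneg _ _ hr0.le, ← ENNReal.rpow_mul, one_div_mul_cancel hr0.ne', ENNReal.rpow_one,
              mul_comm]
    calc ∫⁻ x, H x ^ r * w x ≤ ∫⁻ x, 2 ^ r * ∑' k, (d ^ r) ^ k * (F k x ^ r * w x) := by
          refine lintegral_mono fun x => ?_
          refine (mul_le_mul_left (hpt x) _).trans (le_of_eq ?_)
          rw [mul_assoc, ← ENNReal.tsum_mul_right]
          simp only [mul_assoc]
      _ = 2 ^ r * ∑' k, (d ^ r) ^ k * ∫⁻ x, (F k x ^ r * w x) := by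
          rw [lintegral_const_mul' _ _ (two_rpow_ne_top _), lintegral_tsum]
          · congr 1
            refine tsum_congr fun k => ?_
            have hm : Measurable (fun x => F k x ^ r * w x) := ((hFm k).pow_const _).mul hw.1
            rw [lintegral_const_mul _ hm]
          · intro k
            exact ((((hFm k).pow_const _).mul hw.1).const_mul _).aemeasurable
      _ ≤ 2 ^ r * ∑' k, (2⁻¹) ^ k * ∫⁻ x, h x ^ r * w x := by
          refine mul_le_mul_right (ENNReal.tsum_le_tsum fun k => ?_) _
          refine (mul_le_mul_right (hFI k) _).trans ?_
          rw [← mul_assoc, ← mul_pow]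
          refine mul_le_mul_left ?_ _
          exact pow_le_pow_left' hdr k
      _ = _ := by rw [ENNReal.tsum_mul_right, tsum_half, mul_assoc]
  · apply isA1_of_hmax
    intro x
    refine (hmax_tsum_le F hFm (fun k => c ^ k) x).trans ?_
    have : ∑' k, c ^ k * hmax volume (F k) x = c⁻¹ * ∑' k, c ^ (k+1) * F (k+1) x := by
      rw [← ENNReal.tsum_mul_left]
      refine tsum_congr fun k => ?_
      rw [hFs, pow_succ', mul_assoc, ← mul_assoc c⁻¹, ENNReal.inv_mul_cancel hc0 hct, one_mul]
    rw [this]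
    refine mul_le_mul_right ?_ _
    exact ENNReal.tsum_comp_le_tsum_of_injective (add_left_injective 1) (fun k => c ^ k * F k x)


/-! ### Factorization -/

lemma apConst_le {n : ℕ} {w : Eucl n → ℝ≥0∞} {p : ℝ} (hp : 1 < p) {K : ℝ≥0∞}
    (h : ∀ (x : Eucl n) (r : ℝ), 0 < r →
      (∫⁻ y in cubeSet x r, w y) * (∫⁻ y in cubeSet x r, w y ^ (-(1/(p-1)))) ^ (p-1)
        ≤ K * volume (cubeSet x r) ^ p) : apConst n p w ≤ K := by
  unfold apConst
  refine iSup_le fun x => iSup_le fun r => iSup_le fun hr => ?_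
  have := h x r hr
  have hV0 := volume_cubeSet_ne_zero x hr
  have hVt := volume_cubeSet_ne_top x hr
  rw [ap_term hp (volume (cubeSet x r)) _ _ hV0 hVt] at this
  exact (ENNReal.mul_le_mul_iff_left (by simp [hV0, hVt]) (by simp [hV0, hVt])).1 this

lemma IsA1.int_ne_top {n : ℕ} {A : ℝ≥0∞} (hA : A ≠ ⊤) {H : Eucl n → ℝ≥0∞} (hH : IsWeight H) (h : IsA1 A H)
    (x : Eucl n) {r : ℝ} (hr : 0 < r) : ∫⁻ z in cubeSet x r, H z ≠ ⊤ := by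
  have hV0 := volume_cubeSet_ne_zero x hr
  have hVt := volume_cubeSet_ne_top x hr
  have : ∃ y ∈ cubeSet x r, H y < ⊤ := by
    by_contra hcon
    push Not at hcon
    have h1 : volume (cubeSet x r) = 0 := by
      refine measure_mono_null ?_ (ae_iff.1 hH.2)
      intro y hy
      simp only [Set.mem_ofPred_eq, not_and, not_lt]
      intro _
      exact hcon y hy
    exact hV0 h1
  obtain ⟨y, hy, hyt⟩ := this
  exact ne_top_of_le_ne_top (ENNReal.mul_ne_top (ENNReal.mul_ne_top hA hVt) hyt.ne) (h x r hr y hy)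

lemma isWeight_factor {n : ℕ} {H1 H2 : Eucl n → ℝ≥0∞} (hH1 : IsWeight H1) (hH2 : IsWeight H2) (s : ℝ) :
    IsWeight (fun x => H2 x * H1 x ^ s) := by
  refine ⟨hH2.1.mul (hH1.1.pow_const _), ?_⟩
  filter_upwards [hH1.2, hH2.2] with x h1 h2
  refine ⟨ENNReal.mul_pos h2.1.ne' (ENNReal.rpow_pos h1.1 h1.2.ne).ne', ENNReal.mul_lt_top h2.2 ?_⟩
  exact (ENNReal.rpow_ne_top_of_ne_zero h1.1.ne' h1.2.ne).lt_top

lemma apConst_factor {n : ℕ} {A : ℝ≥0∞} (hA : A ≠ ⊤) {H1 H2 : Eucl n → ℝ≥0∞} (hH1 : IsWeight H1) (hH2 : IsWeight H2)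
    (h1 : IsA1 A H1) (h2 : IsA1 A H2) {p : ℝ} (hp : 1 < p) :
    apConst n p (fun x => H2 x * H1 x ^ (1 - p)) ≤ A ^ p := by
  have hp1 : 0 < p - 1 := by linarith
  refine apConst_le hp fun x r hr => ?_
  have hV0 := volume_cubeSet_ne_zero x hr
  have hVt := volume_cubeSet_ne_top x hr
  have hI1 := hH1.int_ne_zero x hr
  have hI2 := hH2.int_ne_zero x hr
  have hI1t := h1.int_ne_top hA hH1 x hr
  have hI2t := h2.int_ne_top hA hH2 x hr
  have hA0 : A ≠ 0 := by
    rintro rfl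
    apply hI1
    have := h1 x r hr x (mem_cubeSet_self x hr.le)
    simpa using this
  have g1 := h1 x r hr
  have g2 := h2 x r hr
  rw [← ENNReal.mul_rpow_of_nonneg _ _ (by linarith)]
  set B := A * volume (cubeSet x r) with hB
  have hB0 : B ≠ 0 := mul_ne_zero hA0 hV0
  have hBt : B ≠ ⊤ := ENNReal.mul_ne_top hA hVt
  set I1 := ∫⁻ z in cubeSet x r, H1 z
  set I2 := ∫⁻ z in cubeSet x r, H2 z
  set m1 := B⁻¹ * I1 with hm1
  set m2 := B⁻¹ * I2 with hm2
  have em1 : I1 = B * m1 := by rw [hm1, ← mul_assoc, ENNReal.mul_inv_cancel hB0 hBt, one_mul]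
  have em2 : I2 = B * m2 := by rw [hm2, ← mul_assoc, ENNReal.mul_inv_cancel hB0 hBt, one_mul]
  have hm10 : m1 ≠ 0 := mul_ne_zero (by simp [hBt]) hI1
  have hm20 : m2 ≠ 0 := mul_ne_zero (by simp [hBt]) hI2
  have hm1t : m1 ≠ ⊤ := ENNReal.mul_ne_top (by simp [hB0]) hI1t
  have hm2t : m2 ≠ ⊤ := ENNReal.mul_ne_top (by simp [hB0]) hI2t
  have k1 : ∀ y ∈ cubeSet x r, m1 ≤ H1 y := by
    intro y hy
    rw [hm1]
    refine (mul_le_mul_right (g1 y hy) _).trans ?_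
    rw [← mul_assoc, ENNReal.inv_mul_cancel hB0 hBt, one_mul]
  have k2 : ∀ y ∈ cubeSet x r, m2 ≤ H2 y := by
    intro y hy
    rw [hm2]
    refine (mul_le_mul_right (g2 y hy) _).trans ?_
    rw [← mul_assoc, ENNReal.inv_mul_cancel hB0 hBt, one_mul]
  have hneg : ∀ (t : ℝ), 0 ≤ t → ∀ {a b : ℝ≥0∞}, a ≤ b → b ^ (-t) ≤ a ^ (-t) := by
    intro t ht a b hab
    rw [ENNReal.rpow_neg, ENNReal.rpow_neg]
    exact ENNReal.inv_le_inv.2 (ENNReal.rpow_le_rpow hab ht)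
  have J1 : ∫⁻ y in cubeSet x r, H2 y * H1 y ^ (1 - p) ≤ m1 ^ (-(p-1)) * I2 := by
    rw [← lintegral_const_mul _ hH2.1]
    refine setLIntegral_mono (hH2.1.const_mul _) fun y hy => ?_
    rw [mul_comm, show 1 - p = -(p-1) by ring]
    exact mul_le_mul_left (hneg _ hp1.le (k1 y hy)) _
  have J2 : ∫⁻ y in cubeSet x r, (H2 y * H1 y ^ (1 - p)) ^ (-(1/(p-1))) ≤ m2 ^ (-(1/(p-1))) * I1 := by
    rw [← lintegral_const_mul _ hH1.1]
    refine lintegral_mono_ae ?_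
    filter_upwards [ae_restrict_of_ae hH1.2, ae_restrict_of_ae hH2.2, ae_restrict_mem (measurableSet_cubeSet x r)]
      with y q1 q2 hy
    rw [ENNReal.mul_rpow_of_ne_zero q2.1.ne' (ENNReal.rpow_pos q1.1 q1.2.ne).ne', ← ENNReal.rpow_mul,
      show (1 - p) * -(1/(p-1)) = 1 by field_simp; ring, ENNReal.rpow_one]
    exact mul_le_mul_left (hneg _ (by positivity) (k2 y hy)) _
  calc _ ≤ (m1 ^ (-(p-1)) * I2) * (m2 ^ (-(1/(p-1))) * I1) ^ (p-1) := by
        exact mul_le_mul' J1 (ENNReal.rpow_le_rpow J2 hp1.le)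
    _ = (m1 ^ (-(p-1)) * (B * m2)) * (m2 ^ (-(1/(p-1))) * (B * m1)) ^ (p-1) := by rw [em1, em2]
    _ = ((m1 ^ (p-1))⁻¹ * m1 ^ (p-1)) * (m2⁻¹ * m2) * (B * B ^ (p-1)) := by
        rw [ENNReal.mul_rpow_of_nonneg _ _ hp1.le, ENNReal.mul_rpow_of_nonneg _ _ hp1.le, ← ENNReal.rpow_mul,
          show -(1/(p-1)) * (p-1) = -1 by field_simp, ENNReal.rpow_neg_one, ENNReal.rpow_neg]
        ring
    _ = B ^ p := by
        rw [ENNReal.inv_mul_cancel (by simp [hm10, hm1t]) (by simp [hm10, hm1t]), ENNReal.inv_mul_cancel hm20 hm2t,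
          rpow_self_mul hp.le, one_mul, one_mul]
    _ ≤ _ := le_rfl

lemma isWeight_one {n : ℕ} : IsWeight (fun _ : Eucl n => (1 : ℝ≥0∞)) :=
  ⟨measurable_const, by simp⟩

lemma isA1_one {n : ℕ} {A : ℝ≥0∞} (hA : 1 ≤ A) : IsA1 A (fun _ : Eucl n => (1 : ℝ≥0∞)) := by
  intro x r hr y hy
  simp only [lintegral_const, one_mul, mul_one, MeasurableSet.univ, Measure.restrict_apply, Set.univ_inter]
  exact le_mul_of_one_le_left' hA

lemma IsA1.mono {n : ℕ} {A B : ℝ≥0∞} (h : A ≤ B) {H : Eucl n → ℝ≥0∞} (hH : IsA1 A H) : IsA1 B H := by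
  intro x r hr y hy
  refine (hH x r hr y hy).trans ?_
  gcongr


/-! ### Extrapolation -/

lemma weighted_holder {n : ℕ} {v : Eucl n → ℝ≥0∞} (hv : IsWeight v) {r : ℝ} (hr : 1 < r)
    {F G : Eucl n → ℝ≥0∞} (hF : Measurable F) (hG : Measurable G) :
    ∫⁻ x, F x * G x ≤ (∫⁻ x, F x ^ r * v x) ^ (1/r) *
      (∫⁻ x, G x ^ (r/(r-1)) * v x ^ (-(1/(r-1)))) ^ (1/(r/(r-1))) := by
  have hr0 : 0 < r := by linarith
  have hr1 : 0 < r - 1 := by linarith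
  have hconj : r.HolderConjugate (r/(r-1)) := Real.HolderConjugate.conjExponent hr
  have h := ENNReal.lintegral_mul_le_Lp_mul_Lq volume hconj
    (f := fun x => F x * v x ^ (1/r)) (g := fun x => G x * v x ^ (-(1/r)))
    (hF.mul (hv.1.pow_const _)).aemeasurable (hG.mul (hv.1.pow_const _)).aemeasurable
  have e0 : ∫⁻ x, F x * G x = ∫⁻ x, ((fun x => F x * v x ^ (1/r)) * fun x => G x * v x ^ (-(1/r))) x := by
    apply lintegral_congr_ae
    filter_upwards [hv.2] with x hx
    have : v x ^ (1/r) * v x ^ (-(1/r)) = 1 := by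
      rw [← ENNReal.rpow_add _ _ hx.1.ne' hx.2.ne]; simp
    simp only [Pi.mul_apply]
    rw [mul_mul_mul_comm, this, mul_one]
  have e1 : ∫⁻ x, (F x * v x ^ (1/r)) ^ r = ∫⁻ x, F x ^ r * v x := by
    refine lintegral_congr fun x => ?_
    rw [ENNReal.mul_rpow_of_nonneg _ _ hr0.le, ← ENNReal.rpow_mul, one_div_mul_cancel hr0.ne', ENNReal.rpow_one]
  have e2 : ∫⁻ x, (G x * v x ^ (-(1/r))) ^ (r/(r-1)) = ∫⁻ x, G x ^ (r/(r-1)) * v x ^ (-(1/(r-1))) := by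
    refine lintegral_congr fun x => ?_
    rw [ENNReal.mul_rpow_of_nonneg _ _ (by positivity), ← ENNReal.rpow_mul]
    congr 2
    field_simp
  rw [e0]
  refine h.trans (le_of_eq ?_)
  rw [e1, e2]

lemma iUnion_cubeSet {n : ℕ} (y : Eucl n) : (⋃ m : ℕ, cubeSet y ((m : ℝ) + 1)) = Set.univ := by
  refine Set.eq_univ_of_forall fun z => ?_
  obtain ⟨m, hm⟩ := exists_nat_ge ‖y - z‖
  refine Set.mem_iUnion.2 ⟨m, fun i => ?_⟩
  have := PiLp.norm_apply_le (y - z) i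
  simp only [PiLp.sub_apply, Real.norm_eq_abs] at this
  linarith

lemma IsA1.isWeight {n : ℕ} {A : ℝ≥0∞} {h H v : Eucl n → ℝ≥0∞} (hH : Measurable H) (hA : IsA1 A H)
    (hle : ∀ x, h x ≤ H x) (hne : ¬ (h =ᵐ[volume] 0)) (hv : IsWeight v) {r : ℝ} (hr : 0 < r)
    (hfin : ∫⁻ x, H x ^ r * v x ≠ ⊤) : IsWeight H := by
  refine ⟨hH, ?_⟩
  have hpos : ∀ y, 0 < H y := by
    intro y
    rw [pos_iff_ne_zero]
    intro h0
    apply hne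
    have hH0 : ∫⁻ z, H z = 0 := by
      rw [← setLIntegral_univ, ← iUnion_cubeSet y]
      refine le_antisymm ((lintegral_iUnion_le _ _).trans ?_) zero_le
      refine le_of_eq (ENNReal.tsum_eq_zero.2 fun m => ?_)
      have := hA y ((m : ℝ) + 1) (by positivity) y (mem_cubeSet_self y (by positivity))
      simpa [h0] using this
    rw [lintegral_eq_zero_iff hH] at hH0
    filter_upwards [hH0] with x hx
    exact le_antisymm ((hle x).trans hx.le) zero_le
  filter_upwards [ae_lt_top ((hH.pow_const r).mul hv.1) hfin, hv.2] with x hx hvx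
  refine ⟨hpos x, ?_⟩
  rw [lt_top_iff_ne_top]
  intro ht
  simp [ht, hr, ENNReal.top_mul hvx.1.ne'] at hx

lemma factor_use {n : ℕ} {p : ℝ} (hp : 1 < p) {N : ℝ → ℝ} (hN : MonotoneOn N (Set.Ici 1))
    {f g : Eucl n → ℝ} (hfg : memF n p N f g)
    {A : ℝ≥0∞} (hA : A ≠ ⊤) {H1 H2 : Eucl n → ℝ≥0∞} (hH1 : IsWeight H1) (hH2 : IsWeight H2)
    (h1 : IsA1 A H1) (h2 : IsA1 A H2) :
    (∫⁻ x, (‖f x‖₊ : ℝ≥0∞) ^ p * (H2 x * H1 x ^ (1 - p))) ^ (1/p) ≤ ENNReal.ofReal (N ((A ^ p).toReal)) *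
      (∫⁻ x, (‖g x‖₊ : ℝ≥0∞) ^ p * (H2 x * H1 x ^ (1 - p))) ^ (1/p) := by
  have hW := isWeight_factor hH1 hH2 (1 - p)
  have hap := apConst_factor hA hH1 hH2 h1 h2 hp
  have hAp : A ^ p ≠ ⊤ := ENNReal.rpow_ne_top_of_nonneg (by linarith) hA
  have hone := one_le_apConst hW hp
  have h := hfg.2.2 _ ⟨hW, lt_of_le_of_lt hap hAp.lt_top⟩
  unfold wLp wLpE at h
  refine h.trans (mul_le_mul_left (ENNReal.ofReal_le_ofReal ?_) _)
  have t1 : (apConst n p fun x => H2 x * H1 x ^ (1 - p)).toReal ≤ (A ^ p).toReal := ENNReal.toReal_mono hAp hap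
  have t0 : 1 ≤ (apConst n p fun x => H2 x * H1 x ^ (1 - p)).toReal := by
    have := ENNReal.toReal_mono (ne_top_of_le_ne_top hAp hap) hone
    simpa using this
  exact hN t0 (le_trans t0 t1) t1

lemma factor_bound {n : ℕ} {p : ℝ} (hp : 1 < p) {N : ℝ → ℝ} (hN : MonotoneOn N (Set.Ici 1))
    {f g : Eucl n → ℝ} (hfg : memF n p N f g)
    {A : ℝ≥0∞} (hA : A ≠ ⊤) {H1 H2 : Eucl n → ℝ≥0∞} (hH1 : IsWeight H1) (hH2 : IsWeight H2)
    (h1 : IsA1 A H1) (h2 : IsA1 A H2) (hg : ∀ x, (‖g x‖₊ : ℝ≥0∞) ≤ H1 x) :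
    ∫⁻ x, (‖f x‖₊ : ℝ≥0∞) * H2 x ≤ ENNReal.ofReal (N ((A ^ p).toReal)) * ∫⁻ x, H1 x * H2 x := by
  have hp1 : 0 < p - 1 := by linarith
  have hW := isWeight_factor hH1 hH2 (1 - p)
  have hfm : Measurable (fun x => (‖f x‖₊ : ℝ≥0∞)) := hfg.1.nnnorm.coe_nnreal_ennreal
  have hh := weighted_holder hW hp hfm hH2.1
  have e2 : ∫⁻ x, H2 x ^ (p/(p-1)) * (H2 x * H1 x ^ (1 - p)) ^ (-(1/(p-1))) = ∫⁻ x, H1 x * H2 x := by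
    apply lintegral_congr_ae
    filter_upwards [hH1.2, hH2.2] with x q1 q2
    rw [ENNReal.mul_rpow_of_ne_zero q2.1.ne' (ENNReal.rpow_pos q1.1 q1.2.ne).ne', ← ENNReal.rpow_mul,
      show (1 - p) * -(1/(p-1)) = 1 by field_simp; ring, ENNReal.rpow_one, ← mul_assoc,
      ← ENNReal.rpow_add _ _ q2.1.ne' q2.2.ne, show p/(p-1) + -(1/(p-1)) = 1 by field_simp; ring, ENNReal.rpow_one,
      mul_comm]
  have e3 : ∫⁻ x, (‖g x‖₊ : ℝ≥0∞) ^ p * (H2 x * H1 x ^ (1 - p)) ≤ ∫⁻ x, H1 x * H2 x := by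
    refine lintegral_mono_ae ?_
    filter_upwards [hH1.2, hH2.2] with x q1 q2
    calc (‖g x‖₊ : ℝ≥0∞) ^ p * (H2 x * H1 x ^ (1 - p)) ≤ H1 x ^ p * (H2 x * H1 x ^ (1 - p)) := by
          gcongr; exact hg x
      _ = (H1 x ^ p * H1 x ^ (1 - p)) * H2 x := by ring
      _ = _ := by rw [← ENNReal.rpow_add _ _ q1.1.ne' q1.2.ne, show p + (1-p) = 1 by ring, ENNReal.rpow_one]
  rw [e2] at hh
  refine hh.trans ?_
  calc _ ≤ (ENNReal.ofReal (N ((A ^ p).toReal)) * (∫⁻ x, H1 x * H2 x) ^ (1/p)) *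
        (∫⁻ x, H1 x * H2 x) ^ (1/(p/(p-1))) := by
        refine mul_le_mul_left ?_ _
        refine (factor_use hp hN hfg hA hH1 hH2 h1 h2).trans ?_
        refine mul_le_mul_right (ENNReal.rpow_le_rpow e3 (by positivity)) _
    _ = _ := by
        rw [mul_assoc, ← ENNReal.rpow_add_of_nonneg _ _ (by positivity) (by positivity),
          show 1/p + 1/(p/(p-1)) = 1 by field_simp; ring, ENNReal.rpow_one]

theorem extrap (n : ℕ) {p u : ℝ} (hp : 1 < p) (hu : 1 < u) {N : ℝ → ℝ} (hN : MonotoneOn N (Set.Ici 1))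
    {K : ℝ≥0∞} (hK : K ≠ ⊤) :
    ∃ C : ℝ≥0∞, C ≠ ⊤ ∧ ∀ w : Eucl n → ℝ≥0∞, IsWeight w → apConst n u w ≤ K →
      ∀ f g : Eucl n → ℝ, memF n p N f g →
        ∫⁻ x, (‖f x‖₊ : ℝ≥0∞) ^ u * w x ≤ C * ∫⁻ x, (‖g x‖₊ : ℝ≥0∞) ^ u * w x := by
  have hu0 : 0 < u := by linarith
  have hu1 : 0 < u - 1 := by linarith
  set u' := u / (u - 1) with hu'
  set s := 1 / (u - 1) with hs
  have hs0 : 0 < s := by positivity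
  have hu'1 : 1 < u' := by rw [hu', lt_div_iff₀ hu1]; linarith
  have hu's : u' = 1 + s := by rw [hu', hs]; field_simp; ring
  have huu : 1/u + 1/u' = 1 := by rw [hu']; field_simp; ring
  obtain ⟨C1, A1, hC1, hA1, R1⟩ := rubio n hu hK
  obtain ⟨C2, A2, hC2, hA2, R2⟩ := rubio n hu'1 (K := K ^ s) (ENNReal.rpow_ne_top_of_nonneg hs0.le hK)
  set A := max (max A1 A2) 1 with hAd
  have hA : A ≠ ⊤ := by simp [hAd, hA1, hA2]
  set c := ENNReal.ofReal (N ((A ^ p).toReal)) with hc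
  set D := c * C1 ^ (1/u) * C2 ^ (1/u') with hD
  have hDt : D ≠ ⊤ := by
    refine ENNReal.mul_ne_top (ENNReal.mul_ne_top ENNReal.ofReal_ne_top ?_) ?_
    · exact ENNReal.rpow_ne_top_of_nonneg (by positivity) hC1
    · exact ENNReal.rpow_ne_top_of_nonneg (by positivity) hC2
  refine ⟨D ^ u + 1, ?_, ?_⟩
  · simp [hDt, hu0.le]
  intro w hw hwK f g hfg
  have hKw : apConst n u w ≠ ⊤ := ne_top_of_le_ne_top hK hwK
  set F : Eucl n → ℝ≥0∞ := fun x => (‖f x‖₊ : ℝ≥0∞) with hF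
  set G : Eucl n → ℝ≥0∞ := fun x => (‖g x‖₊ : ℝ≥0∞) with hG
  have hFm : Measurable F := hfg.1.nnnorm.coe_nnreal_ennreal
  have hGm : Measurable G := hfg.2.1.nnnorm.coe_nnreal_ennreal
  change ∫⁻ x, F x ^ u * w x ≤ (D ^ u + 1) * ∫⁻ x, G x ^ u * w x
  set Y := ∫⁻ x, G x ^ u * w x with hY
  by_cases hYt : Y = ⊤
  · rw [hYt, ENNReal.mul_top (by simp)]; exact le_top
  by_cases hG0 : G =ᵐ[volume] 0
  · have h1 := factor_use hp hN hfg hA isWeight_one isWeight_one (isA1_one (le_max_right _ _))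
      (isA1_one (le_max_right _ _))
    have h2 : ∫⁻ x, G x ^ p * ((1:ℝ≥0∞) * 1 ^ (1 - p)) = 0 := by
      rw [lintegral_eq_zero_iff' (by fun_prop)]
      filter_upwards [hG0] with x hx
      simp [hx]; linarith
    rw [h2, ENNReal.zero_rpow_of_pos (by positivity), mul_zero, nonpos_iff_eq_zero,
      ENNReal.rpow_eq_zero_iff_of_pos (by positivity), lintegral_eq_zero_iff' (by have := hfg.1; fun_prop)] at h1
    have h3 : ∫⁻ x, F x ^ u * w x = 0 := by
      rw [lintegral_eq_zero_iff' (by have := hw.1; fun_prop)]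
      filter_upwards [h1] with x hx
      have : F x = 0 := by
        by_contra hne
        have hx' : F x ^ p * ((1:ℝ≥0∞) * 1 ^ (1 - p)) = 0 := hx
        simp only [ENNReal.one_rpow, mul_one] at hx'
        rw [ENNReal.rpow_eq_zero_iff_of_pos (by linarith)] at hx'
        exact hne hx'
      simp [this, hu0]
    rw [h3]; exact zero_le
  obtain ⟨H1, hH1m, hH1le, hH1b, hH1A⟩ := R1 w hw hwK G hGm
  have hH1w : IsWeight H1 := hH1A.isWeight hH1m hH1le hG0 hw hu0
    (ne_top_of_le_ne_top (ENNReal.mul_ne_top hC1 hYt) hH1b)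
  have hH1A' : IsA1 A H1 := hH1A.mono (by simp [hAd])
  set σ : Eucl n → ℝ≥0∞ := fun x => w x ^ (-s) with hσ
  have hσw : IsWeight σ := hw.dual _
  have hσK : apConst n u' σ ≤ K ^ s := (apConst_dual hu).trans (ENNReal.rpow_le_rpow hwK hs0.le)
  have key : ∀ m : ℕ, ∫⁻ x, ((cubeSet (0 : Eucl n) ((m:ℝ)+1)).indicator (fun x => min (F x) m) x) ^ u * w x
      ≤ D ^ u * Y := by
    intro m
    have hmp : (0:ℝ) < (m:ℝ) + 1 := by positivity
    set Q := cubeSet (0 : Eucl n) ((m:ℝ)+1)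
    set φ : Eucl n → ℝ≥0∞ := Q.indicator (fun x => min (F x) m) with hφ
    have hφm : Measurable φ := (hFm.min measurable_const).indicator (measurableSet_cubeSet _ _)
    have hφF : ∀ x, φ x ≤ F x := fun x => (Set.indicator_le_self' (fun _ _ => zero_le) x).trans (min_le_left _ _)
    set X := ∫⁻ x, φ x ^ u * w x with hX
    have hXt : X ≠ ⊤ := by
      have hle : X ≤ (m : ℝ≥0∞) ^ u * ∫⁻ x in Q, w x := by
        rw [← lintegral_const_mul _ hw.1, ← lintegral_indicator (measurableSet_cubeSet _ _)]
        refine lintegral_mono fun x => ?_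
        by_cases hx : x ∈ Q
        · rw [Set.indicator_of_mem hx, hφ, Set.indicator_of_mem hx]
          gcongr
          exact min_le_right _ _
        · rw [hφ, Set.indicator_of_notMem hx]
          simp [hu0]
      refine ne_top_of_le_ne_top (ENNReal.mul_ne_top ?_ (ap_int_ne_top hw hu hKw _ hmp)) hle
      exact ENNReal.rpow_ne_top_of_nonneg hu0.le (by simp)
    by_cases hX0 : X = 0
    · rw [hX0]; exact zero_le
    set k : Eucl n → ℝ≥0∞ := fun x => φ x ^ (u - 1) * w x with hk
    have hkm : Measurable k := (hφm.pow_const _).mul hw.1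
    have hφk : ∫⁻ x, φ x * k x = X := by
      refine lintegral_congr fun x => ?_
      simp only [hk]
      rw [← mul_assoc, rpow_self_mul hu.le]
    have hk0 : ¬ (k =ᵐ[volume] 0) := by
      intro h0
      apply hX0
      have hm : Measurable (fun x => φ x * k x) := hφm.mul hkm
      rw [← hφk, lintegral_eq_zero_iff hm]
      filter_upwards [h0] with x hx
      simp [hx]
    have hkX : ∫⁻ x, k x ^ u' * σ x = X := by
      apply lintegral_congr_ae
      filter_upwards [hw.2] with x hx
      simp only [hk, hσ]
      rw [ENNReal.mul_rpow_of_nonneg _ _ (by linarith), ← ENNReal.rpow_mul, mul_assoc,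
        ← ENNReal.rpow_add _ _ hx.1.ne' hx.2.ne, show u' + -s = 1 by linarith, ENNReal.rpow_one,
        show (u - 1) * u' = u by rw [hu']; field_simp]
    obtain ⟨H2, hH2m, hH2le, hH2b, hH2A⟩ := R2 σ hσw hσK k hkm
    rw [hkX] at hH2b
    have hH2w : IsWeight H2 := hH2A.isWeight hH2m hH2le hk0 hσw (by linarith)
      (ne_top_of_le_ne_top (ENNReal.mul_ne_top hC2 hXt) hH2b)
    have hH2A' : IsA1 A H2 := hH2A.mono (by simp [hAd])
    have hfb := factor_bound hp hN hfg hA hH1w hH2w hH1A' hH2A' hH1le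
    have hho := weighted_holder hw hu hH1m hH2m
    have hmain : X ≤ D * Y ^ (1/u) * X ^ (1/u') := by
      calc X = ∫⁻ x, φ x * k x := hφk.symm
        _ ≤ ∫⁻ x, F x * H2 x := lintegral_mono fun x => mul_le_mul' (hφF x) (hH2le x)
        _ ≤ c * ∫⁻ x, H1 x * H2 x := hfb
        _ ≤ c * ((∫⁻ x, H1 x ^ u * w x) ^ (1/u) * (∫⁻ x, H2 x ^ u' * σ x) ^ (1/u')) := mul_le_mul_right hho _
        _ ≤ c * ((C1 * Y) ^ (1/u) * (C2 * X) ^ (1/u')) := by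
            refine mul_le_mul_right (mul_le_mul' ?_ ?_) _
            · exact ENNReal.rpow_le_rpow hH1b (by positivity)
            · exact ENNReal.rpow_le_rpow hH2b (by positivity)
        _ = _ := by
            rw [ENNReal.mul_rpow_of_nonneg _ _ (by positivity), ENNReal.mul_rpow_of_nonneg _ _ (by positivity), hD]
            ring
    have hdiv : X ^ (1/u) ≤ D * Y ^ (1/u) := by
      have e : X = X ^ (1/u) * X ^ (1/u') := by
        rw [← ENNReal.rpow_add _ _ hX0 hXt, huu, ENNReal.rpow_one]
      have hm2 : X ^ (1/u) * X ^ (1/u') ≤ D * Y ^ (1/u) * X ^ (1/u') := e.symm.le.trans hmain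
      exact (ENNReal.mul_le_mul_iff_left (by simp [hX0, hXt]) (by simp [hX0, hXt])).1 hm2
    calc X = (X ^ (1/u)) ^ u := by rw [← ENNReal.rpow_mul, one_div_mul_cancel hu0.ne', ENNReal.rpow_one]
      _ ≤ (D * Y ^ (1/u)) ^ u := ENNReal.rpow_le_rpow hdiv hu0.le
      _ = _ := by
        rw [ENNReal.mul_rpow_of_nonneg _ _ hu0.le, ← ENNReal.rpow_mul, one_div_mul_cancel hu0.ne', ENNReal.rpow_one]
  have hlim : ∀ x, Tendsto (fun m : ℕ => ((cubeSet (0 : Eucl n) ((m:ℝ)+1)).indicator (fun x => min (F x) m) x) ^ u * w x)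
      atTop (𝓝 (F x ^ u * w x)) := by
    intro x
    refine tendsto_const_nhds.congr' ?_
    obtain ⟨m1, hm1⟩ := exists_nat_ge ‖x‖
    obtain ⟨m2, hm2⟩ := exists_nat_ge ‖f x‖₊
    filter_upwards [eventually_ge_atTop (max m1 m2)] with m hm
    have hx : x ∈ cubeSet (0 : Eucl n) ((m:ℝ)+1) := by
      intro i
      have := PiLp.norm_apply_le x i
      have h3 : (m1 : ℝ) ≤ m := by exact_mod_cast (le_max_left _ _).trans hm
      simp only [Real.norm_eq_abs] at this
      simp only [PiLp.zero_apply, zero_sub, abs_neg]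
      linarith
    rw [Set.indicator_of_mem hx, min_eq_left]
    have h4 : ‖f x‖₊ ≤ (m : ℝ≥0) := hm2.trans (by exact_mod_cast (le_max_right _ _).trans hm)
    simp only [hF]
    exact_mod_cast h4
  calc ∫⁻ x, F x ^ u * w x = ∫⁻ x, liminf (fun m : ℕ =>
        ((cubeSet (0 : Eucl n) ((m:ℝ)+1)).indicator (fun x => min (F x) m) x) ^ u * w x) atTop :=
        lintegral_congr fun x => (hlim x).liminf_eq.symm
    _ ≤ liminf (fun m : ℕ => ∫⁻ x,
        ((cubeSet (0 : Eucl n) ((m:ℝ)+1)).indicator (fun x => min (F x) m) x) ^ u * w x) atTop := by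
        refine lintegral_liminf_le fun m => ?_
        exact (((hFm.min measurable_const).indicator (measurableSet_cubeSet _ _)).pow_const _).mul hw.1
    _ ≤ D ^ u * Y := by
        refine Filter.liminf_le_of_frequently_le' (Frequently.of_forall key)
    _ ≤ _ := by gcongr; exact le_self_add


/-! ### Power weights -/

lemma rpow_neg_anti {t : ℝ} (ht : 0 ≤ t) {a b : ℝ≥0∞} (hab : a ≤ b) : b ^ (-t) ≤ a ^ (-t) := by
  rw [ENNReal.rpow_neg, ENNReal.rpow_neg]
  exact ENNReal.inv_le_inv.2 (ENNReal.rpow_le_rpow hab ht)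

lemma ae_ne_zero {n : ℕ} (hn : 1 ≤ n) : ∀ᵐ x ∂(volume : Measure (Eucl n)), x ≠ 0 := by
  have : Nonempty (Fin n) := ⟨⟨0, hn⟩⟩
  have : Nontrivial (Eucl n) := inferInstance
  exact Measure.ae_ne volume 0

lemma isWeight_norm {n : ℕ} (hn : 1 ≤ n) (a : ℝ) : IsWeight (fun x : Eucl n => ‖x‖ₑ ^ a) := by
  refine ⟨measurable_enorm.pow_const _, ?_⟩
  filter_upwards [ae_ne_zero hn] with x hx
  have h0 : ‖x‖ₑ ≠ 0 := by simpa using hx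
  have ht : ‖x‖ₑ ≠ ⊤ := enorm_ne_top
  exact ⟨ENNReal.rpow_pos (pos_iff_ne_zero.2 h0) ht, (ENNReal.rpow_ne_top_of_ne_zero h0 ht).lt_top⟩

lemma mul_rpow_neg {c x : ℝ≥0∞} (h0 : c ≠ 0) (ht : c ≠ ⊤) (hx : x ≠ 0) (s : ℝ) :
    x ^ (-s) = c ^ s * (c * x) ^ (-s) := by
  rw [ENNReal.mul_rpow_of_ne_zero h0 hx, ← mul_assoc, ← ENNReal.rpow_add _ _ h0 ht]
  simp

lemma power_ball {n : ℕ} (hn : 1 ≤ n) {s : ℝ} (hs0 : 0 ≤ s) {R : ℝ} (hR : 0 < R) :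
    ∫⁻ x in Metric.closedBall (0 : Eucl n) R, ‖x‖ₑ ^ (-s) ≤
      (2 ^ s * ∑' j : ℕ, (2 : ℝ≥0∞) ^ (-(((n : ℝ) - s) * (j : ℝ)))) * volume (cubeSet (0 : Eucl n) R) *
        ENNReal.ofReal R ^ (-s) := by
  set c : ℕ → ℝ≥0∞ := fun j => (2 : ℝ≥0∞) ^ (((j : ℝ) + 1) * s) * ENNReal.ofReal R ^ (-s) with hc
  calc ∫⁻ x in Metric.closedBall (0 : Eucl n) R, ‖x‖ₑ ^ (-s)
      ≤ ∫⁻ x in Metric.closedBall (0 : Eucl n) R,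
          ∑' j : ℕ, (cubeSet (0 : Eucl n) ((2⁻¹ : ℝ) ^ j * R)).indicator (fun _ => c j) x := by
        refine lintegral_mono_ae ?_
        filter_upwards [ae_restrict_of_ae (ae_ne_zero hn), ae_restrict_mem Metric.isClosed_closedBall.measurableSet]
          with x hx hxR
        have hxR' : ‖x‖ ≤ R := by simpa using hxR
        have hx0 : 0 < ‖x‖ := norm_pos_iff.2 hx
        obtain ⟨j, hj1, hj2⟩ := exists_nat_pow_near (x := R / ‖x‖) (y := 2) (by rwa [one_le_div hx0]) (by norm_num)
        refine le_trans ?_ (ENNReal.le_tsum j)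
        have hmem : x ∈ cubeSet (0 : Eucl n) ((2⁻¹ : ℝ) ^ j * R) := by
          intro i
          have := PiLp.norm_apply_le x i
          simp only [Real.norm_eq_abs] at this
          simp only [PiLp.zero_apply, zero_sub, abs_neg]
          refine this.trans ?_
          rw [le_div_iff₀ hx0] at hj1
          rw [inv_pow, inv_mul_eq_div, le_div_iff₀ (by positivity)]
          linarith
        rw [Set.indicator_of_mem hmem]
        rw [div_lt_iff₀ hx0] at hj2
        have h3 : ENNReal.ofReal R ≤ 2 ^ ((j : ℝ) + 1) * ‖x‖ₑ := by
          rw [← ofReal_norm, show (2 : ℝ≥0∞) ^ ((j : ℝ) + 1) = ENNReal.ofReal (2 ^ (j+1)) by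
            rw [ENNReal.ofReal_pow (by norm_num), ← ENNReal.rpow_natCast]; simp,
            ← ENNReal.ofReal_mul (by positivity)]
          exact ENNReal.ofReal_le_ofReal hj2.le
        rw [mul_rpow_neg (two_rpow_ne_zero ((j : ℝ) + 1)) (two_rpow_ne_top _) (by simpa using hx) s, hc,
          ← ENNReal.rpow_mul]
        exact mul_le_mul_right (rpow_neg_anti hs0 h3) _
    _ ≤ ∫⁻ x, ∑' j : ℕ, (cubeSet (0 : Eucl n) ((2⁻¹ : ℝ) ^ j * R)).indicator (fun _ => c j) x :=
        setLIntegral_le_lintegral _ _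
    _ = ∑' j : ℕ, c j * volume (cubeSet (0 : Eucl n) ((2⁻¹ : ℝ) ^ j * R)) := by
        rw [lintegral_tsum]
        · refine tsum_congr fun j => ?_
          rw [lintegral_indicator (measurableSet_cubeSet _ _)]; simp
        · intro j
          exact (measurable_const.indicator (measurableSet_cubeSet _ _)).aemeasurable
    _ = _ := by
        rw [mul_assoc, mul_assoc, ← ENNReal.tsum_mul_right, ← ENNReal.tsum_mul_left]
        refine tsum_congr fun j => ?_
        rw [volume_cubeSet_mul 0 0 hR (by positivity)]
        have e : ENNReal.ofReal (((2⁻¹ : ℝ) ^ j) ^ n) = 2 ^ (-((n : ℝ) * j)) := by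
          rw [ENNReal.rpow_neg, ← pow_mul, ENNReal.ofReal_pow (by norm_num), ENNReal.ofReal_inv_of_pos (by norm_num),
            mul_comm (n : ℝ), ← Nat.cast_mul, ENNReal.rpow_natCast, ← ENNReal.inv_pow]
          simp
        rw [e, hc]
        have e2 : (2 : ℝ≥0∞) ^ (((j : ℝ) + 1) * s) * 2 ^ (-((n : ℝ) * j)) = 2 ^ s * 2 ^ (-(((n : ℝ) - s) * (j : ℝ))) := by
          rw [← two_rpow_add, ← two_rpow_add]; congr 1; ring
        calc _ = ((2 : ℝ≥0∞) ^ (((j : ℝ) + 1) * s) * 2 ^ (-((n : ℝ) * j))) *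
              (volume (cubeSet (0 : Eucl n) R) * ENNReal.ofReal R ^ (-s)) := by ring
          _ = _ := by rw [e2]; ring

lemma norm_sub_le_cube {n : ℕ} {z x y : Eucl n} {r : ℝ} (hx : x ∈ cubeSet z r) (hy : y ∈ cubeSet z r) :
    ‖x - y‖ ≤ n * (2 * r) := by
  have h1 : ∀ i, |x i - y i| ≤ 2 * r := by
    intro i
    have := hx i
    have := hy i
    rw [abs_le] at *
    constructor <;> linarith
  calc ‖x - y‖ = ‖∑ i, EuclideanSpace.single i ((x - y) i)‖ := by
        congr 1
        ext j
        simp [Finset.sum_apply, Pi.single_apply]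
    _ ≤ ∑ i, ‖EuclideanSpace.single i ((x - y) i)‖ := norm_sum_le _ _
    _ ≤ ∑ i : Fin n, 2 * r := by
        refine Finset.sum_le_sum fun i _ => ?_
        simpa using h1 i
    _ = _ := by simp

lemma power_A1 {n : ℕ} (hn : 1 ≤ n) {s : ℝ} (hs0 : 0 ≤ s) (hs : s < n) :
    ∃ A : ℝ≥0∞, A ≠ ⊤ ∧ IsA1 A (fun x : Eucl n => ‖x‖ₑ ^ (-s)) := by
  set D : ℝ≥0∞ := 2 ^ s * ∑' j : ℕ, (2 : ℝ≥0∞) ^ (-(((n : ℝ) - s) * (j : ℝ))) with hD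
  have hDt : D ≠ ⊤ := ENNReal.mul_ne_top (two_rpow_ne_top _) (dySum_nat_ne_top (by linarith))
  have hn0 : (0:ℝ) < n := by exact_mod_cast hn
  refine ⟨2 ^ s + D * ENNReal.ofReal ((6 * n) ^ n), ?_, ?_⟩
  · exact ENNReal.add_ne_top.2 ⟨two_rpow_ne_top _, ENNReal.mul_ne_top hDt ENNReal.ofReal_ne_top⟩
  intro z r hr y hy
  by_cases hcase : 2 * (n * (2 * r)) ≤ ‖y‖
  · calc ∫⁻ x in cubeSet z r, ‖x‖ₑ ^ (-s) ≤ ∫⁻ x in cubeSet z r, 2 ^ s * ‖y‖ₑ ^ (-s) := by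
          refine setLIntegral_mono measurable_const fun x hx => ?_
          have h1 := norm_sub_le_cube hy hx
          have hpos : 0 < n * (2 * r) := by positivity
          have h2 : ‖y‖ ≤ 2 * ‖x‖ := by
            have := norm_sub_norm_le y x
            linarith
          have h3 : ‖y‖ₑ ≤ 2 * ‖x‖ₑ := by
            have h4 := ENNReal.ofReal_le_ofReal h2
            rw [ENNReal.ofReal_mul (by norm_num), ofReal_norm, ofReal_norm] at h4
            simpa using h4
          have hx0 : ‖x‖ₑ ≠ 0 := by
            have : 0 < ‖x‖ := by linarith
            simpa using this
          rw [mul_rpow_neg (c := 2) (by norm_num) (by norm_num) hx0 s]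
          exact mul_le_mul_right (rpow_neg_anti hs0 h3) _
      _ = 2 ^ s * volume (cubeSet z r) * ‖y‖ₑ ^ (-s) := by
          simp only [lintegral_const, MeasurableSet.univ, Measure.restrict_apply, Set.univ_inter]
          ring
      _ ≤ _ := by
          gcongr
          exact le_self_add
  · push Not at hcase
    have hR : 0 < 6 * (n : ℝ) * r := by positivity
    calc ∫⁻ x in cubeSet z r, ‖x‖ₑ ^ (-s) ≤ ∫⁻ x in Metric.closedBall (0 : Eucl n) (6 * n * r), ‖x‖ₑ ^ (-s) := by
          refine lintegral_mono_set fun x hx => ?_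
          have h1 := norm_sub_le_cube hx hy
          have := norm_sub_norm_le x y
          rw [mem_closedBall_zero_iff]
          nlinarith
      _ ≤ D * volume (cubeSet (0 : Eucl n) (6 * n * r)) * ENNReal.ofReal (6 * n * r) ^ (-s) := power_ball hn hs0 hR
      _ ≤ D * (ENNReal.ofReal ((6 * n) ^ n) * volume (cubeSet z r)) * ‖y‖ₑ ^ (-s) := by
          rw [volume_cubeSet_mul 0 z hr (by positivity)]
          refine mul_le_mul_right (rpow_neg_anti hs0 ?_) _
          rw [← ofReal_norm]
          refine ENNReal.ofReal_le_ofReal ?_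
          have hpos : 0 < n * (2 * r) := by positivity
          linarith
      _ ≤ _ := by
          rw [← mul_assoc]
          gcongr
          exact le_add_self

lemma power_Ap {n : ℕ} (hn : 1 ≤ n) {u : ℝ} (hu : 1 < u) {a : ℝ} (ha1 : -(n:ℝ) < a) (ha2 : a < n * (u - 1)) :
    apConst n u (fun x : Eucl n => ‖x‖ₑ ^ a) ≠ ⊤ := by
  have hu1 : 0 < u - 1 := by linarith
  rcases le_total a 0 with h | h
  · obtain ⟨A, hA, hA1⟩ := power_A1 hn (s := -a) (by linarith) (by linarith)
    rw [neg_neg] at hA1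
    have hm : A ⊔ 1 ≠ ⊤ := by simp [hA]
    have := apConst_factor hm isWeight_one (isWeight_norm hn a) (isA1_one le_sup_right)
      (hA1.mono le_sup_left) hu
    simp only [ENNReal.one_rpow, mul_one] at this
    exact ne_top_of_le_ne_top (ENNReal.rpow_ne_top_of_nonneg (by linarith) hm) this
  · obtain ⟨A, hA, hA1⟩ := power_A1 hn (s := a / (u - 1)) (by positivity) (by rwa [div_lt_iff₀ hu1])
    have hm : A ⊔ 1 ≠ ⊤ := by simp [hA]
    have := apConst_factor hm (isWeight_norm hn _) isWeight_one (hA1.mono le_sup_left) (isA1_one le_sup_right) hu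
    simp only [one_mul, ← ENNReal.rpow_mul] at this
    rw [show -(a / (u-1)) * (1 - u) = a by field_simp; ring] at this
    exact ne_top_of_le_ne_top (ENNReal.rpow_ne_top_of_nonneg (by linarith) hm) this

lemma isWeight_const_mul {n : ℕ} {w : Eucl n → ℝ≥0∞} (hw : IsWeight w) {c : ℝ≥0∞} (h0 : c ≠ 0) (ht : c ≠ ⊤) :
    IsWeight (fun x => c * w x) := by
  refine ⟨hw.1.const_mul _, ?_⟩
  filter_upwards [hw.2] with x hx
  exact ⟨ENNReal.mul_pos h0 hx.1.ne', ENNReal.mul_lt_top ht.lt_top hx.2⟩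

lemma apConst_const_mul {n : ℕ} {w : Eucl n → ℝ≥0∞} (hw : IsWeight w) {c : ℝ≥0∞} (h0 : c ≠ 0) (ht : c ≠ ⊤)
    {u : ℝ} (hu : 1 < u) : apConst n u (fun x => c * w x) ≤ apConst n u w := by
  have hu1 : 0 < u - 1 := by linarith
  refine apConst_le hu fun x r hr => ?_
  refine le_trans (le_of_eq ?_) (ap_cube hu x hr)
  rw [lintegral_const_mul _ hw.1]
  have e : ∫⁻ y in cubeSet x r, (c * w y) ^ (-(1/(u-1))) = c ^ (-(1/(u-1))) * ∫⁻ y in cubeSet x r, w y ^ (-(1/(u-1))) := by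
    rw [← lintegral_const_mul _ (hw.1.pow_const _)]
    apply lintegral_congr_ae
    filter_upwards [ae_restrict_of_ae hw.2] with y hy
    rw [ENNReal.mul_rpow_of_ne_zero h0 hy.1.ne']
  rw [e, ENNReal.mul_rpow_of_nonneg _ _ hu1.le, ← ENNReal.rpow_mul, show -(1/(u-1)) * (u-1) = -1 by field_simp,
    ENNReal.rpow_neg_one]
  calc _ = (c * c⁻¹) * ((∫⁻ y in cubeSet x r, w y) * (∫⁻ y in cubeSet x r, w y ^ (-(1/(u-1)))) ^ (u-1)) := by ring
    _ = _ := by rw [ENNReal.mul_inv_cancel h0 ht, one_mul]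

lemma add_rpow_le' (a b : ℝ≥0∞) {t : ℝ} (ht : 0 ≤ t) : (a + b) ^ t ≤ 2 ^ t * (a ^ t + b ^ t) := by
  rcases le_total a b with h | h
  · calc (a + b) ^ t ≤ (2 * b) ^ t := by
          refine ENNReal.rpow_le_rpow ?_ ht
          rw [two_mul]; gcongr
      _ = 2 ^ t * b ^ t := ENNReal.mul_rpow_of_nonneg _ _ ht
      _ ≤ _ := by gcongr; exact le_add_self
  · calc (a + b) ^ t ≤ (2 * a) ^ t := by
          refine ENNReal.rpow_le_rpow ?_ ht
          rw [two_mul]; gcongr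
      _ = 2 ^ t * a ^ t := ENNReal.mul_rpow_of_nonneg _ _ ht
      _ ≤ _ := by gcongr; exact le_self_add

lemma apConst_min {n : ℕ} {w v : Eucl n → ℝ≥0∞} (hw : IsWeight w) 
    {u : ℝ} (hu : 1 < u) : apConst n u (fun x => min (w x) (v x)) ≤ 2 ^ (u-1) * (apConst n u w + apConst n u v) := by
  have hu1 : 0 < u - 1 := by linarith
  refine apConst_le hu fun x r hr => ?_
  set S := ∫⁻ y in cubeSet x r, w y ^ (-(1/(u-1)))
  set T := ∫⁻ y in cubeSet x r, v y ^ (-(1/(u-1)))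
  have h1 : ∫⁻ y in cubeSet x r, (min (w y) (v y)) ^ (-(1/(u-1))) ≤ S + T := by
    rw [← lintegral_add_left (hw.1.pow_const _)]
    refine lintegral_mono fun y => ?_
    rcases le_total (w y) (v y) with h | h
    · simp only [min_eq_left h]; exact le_self_add
    · simp only [min_eq_right h]; exact le_add_self
  have hW : ∫⁻ y in cubeSet x r, min (w y) (v y) ≤ ∫⁻ y in cubeSet x r, w y :=
    lintegral_mono fun y => min_le_left _ _
  have hV : ∫⁻ y in cubeSet x r, min (w y) (v y) ≤ ∫⁻ y in cubeSet x r, v y :=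
    lintegral_mono fun y => min_le_right _ _
  calc _ ≤ (∫⁻ y in cubeSet x r, min (w y) (v y)) * (2 ^ (u-1) * (S ^ (u-1) + T ^ (u-1))) := by
        refine mul_le_mul_right ((ENNReal.rpow_le_rpow h1 hu1.le).trans (add_rpow_le' _ _ hu1.le)) _
    _ = 2 ^ (u-1) * ((∫⁻ y in cubeSet x r, min (w y) (v y)) * S ^ (u-1) +
          (∫⁻ y in cubeSet x r, min (w y) (v y)) * T ^ (u-1)) := by ring
    _ ≤ 2 ^ (u-1) * (apConst n u w * volume (cubeSet x r) ^ u + apConst n u v * volume (cubeSet x r) ^ u) := by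
        refine mul_le_mul_right (add_le_add ?_ ?_) _
        · exact (mul_le_mul_left hW _).trans (ap_cube hu x hr)
        · exact (mul_le_mul_left hV _).trans (ap_cube hu x hr)
    _ = _ := by ring

lemma isWeight_min {n : ℕ} {w v : Eucl n → ℝ≥0∞} (hw : IsWeight w) (hv : IsWeight v) :
    IsWeight (fun x => min (w x) (v x)) := by
  refine ⟨hw.1.min hv.1, ?_⟩
  filter_upwards [hw.2, hv.2] with x h1 h2
  exact ⟨lt_min h1.1 h2.1, (min_le_left _ _).trans_lt h1.2⟩

lemma min_power_weight {n : ℕ} (hn : 1 ≤ n) {u : ℝ} (hu : 1 < u) {a b : ℝ} (ha1 : -(n:ℝ) < a) (ha2 : a < n * (u - 1))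
    (hb1 : -(n:ℝ) < b) (hb2 : b < n * (u - 1)) : ∃ K : ℝ≥0∞, K ≠ ⊤ ∧ ∀ c d : ℝ≥0∞, c ≠ 0 → c ≠ ⊤ → d ≠ 0 → d ≠ ⊤ →
      IsWeight (fun x : Eucl n => min (c * ‖x‖ₑ ^ a) (d * ‖x‖ₑ ^ b)) ∧
      apConst n u (fun x : Eucl n => min (c * ‖x‖ₑ ^ a) (d * ‖x‖ₑ ^ b)) ≤ K := by
  refine ⟨2 ^ (u-1) * (apConst n u (fun x : Eucl n => ‖x‖ₑ ^ a) + apConst n u (fun x : Eucl n => ‖x‖ₑ ^ b)),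
    ENNReal.mul_ne_top (two_rpow_ne_top _) (ENNReal.add_ne_top.2 ⟨power_Ap hn hu ha1 ha2, power_Ap hn hu hb1 hb2⟩), ?_⟩
  intro c d hc0 hct hd0 hdt
  have w1 := isWeight_const_mul (isWeight_norm hn a) hc0 hct
  have w2 := isWeight_const_mul (isWeight_norm hn b) hd0 hdt
  refine ⟨isWeight_min w1 w2, (apConst_min w1 hu).trans ?_⟩
  refine mul_le_mul_right (add_le_add ?_ ?_) _
  · exact apConst_const_mul (isWeight_norm hn a) hc0 hct hu
  · exact apConst_const_mul (isWeight_norm hn b) hd0 hdt hu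


/-! ### Conclusion -/

lemma dySum_shift_left (c : ℝ) (j : ℤ) : ∑' k : ℤ, (2 : ℝ≥0∞) ^ (-(c * |((j - k : ℤ) : ℝ)|)) = dySum c :=
  (Equiv.subLeft j).tsum_eq (fun i : ℤ => (2 : ℝ≥0∞) ^ (-(c * |(i : ℝ)|)))

lemma dySum_shift_right (c : ℝ) (k : ℤ) : ∑' j : ℤ, (2 : ℝ≥0∞) ^ (-(c * |((j - k : ℤ) : ℝ)|)) = dySum c :=
  (Equiv.subRight k).tsum_eq (fun i : ℤ => (2 : ℝ≥0∞) ^ (-(c * |(i : ℝ)|)))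

lemma young_seq {A B : ℤ → ℝ≥0∞} {C : ℝ≥0∞} {ε s : ℝ} (hs : 0 < s)
    (h : ∀ k, A k ≤ C * ∑' j : ℤ, (2 : ℝ≥0∞) ^ (-(ε * |((j - k : ℤ) : ℝ)|)) * B j) :
    ∑' k, A k ^ s ≤ (C ^ s * dySum (ε/2) ^ s * dySum (s * (ε/2))) * ∑' j, B j ^ s := by
  have h1 : ∀ k, A k ^ s ≤ (C ^ s * dySum (ε/2) ^ s) *
      ∑' j : ℤ, (2 : ℝ≥0∞) ^ (-((s * (ε/2)) * |((j - k : ℤ) : ℝ)|)) * B j ^ s := by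
    intro k
    set T := ∑' j : ℤ, (2 : ℝ≥0∞) ^ (-((s * (ε/2)) * |((j - k : ℤ) : ℝ)|)) * B j ^ s with hT
    have h2 : ∀ j, (2 : ℝ≥0∞) ^ (-((ε/2) * |((j - k : ℤ) : ℝ)|)) * B j ≤ T ^ (1/s) := by
      intro j
      rw [one_div, ENNReal.le_rpow_inv_iff hs]
      refine le_trans (le_of_eq ?_) (ENNReal.le_tsum j)
      rw [ENNReal.mul_rpow_of_nonneg _ _ hs.le, ← ENNReal.rpow_mul]
      congr 2
      ring
    have h3 : ∑' j : ℤ, (2 : ℝ≥0∞) ^ (-(ε * |((j - k : ℤ) : ℝ)|)) * B j ≤ dySum (ε/2) * T ^ (1/s) := by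
      rw [← dySum_shift_right (ε/2) k, ← ENNReal.tsum_mul_right]
      refine ENNReal.tsum_le_tsum fun j => ?_
      refine le_trans (le_of_eq ?_) (mul_le_mul_right (h2 j) _)
      rw [← mul_assoc, ← two_rpow_add]
      congr 2
      ring
    calc A k ^ s ≤ (C * (dySum (ε/2) * T ^ (1/s))) ^ s :=
          ENNReal.rpow_le_rpow ((h k).trans (mul_le_mul_right h3 _)) hs.le
      _ = _ := by
          rw [ENNReal.mul_rpow_of_nonneg _ _ hs.le, ENNReal.mul_rpow_of_nonneg _ _ hs.le, ← ENNReal.rpow_mul,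
            one_div_mul_cancel hs.ne', ENNReal.rpow_one, mul_assoc]
  refine (ENNReal.tsum_le_tsum h1).trans (le_of_eq ?_)
  rw [ENNReal.tsum_mul_left, ENNReal.tsum_comm, mul_assoc (C ^ s * dySum (ε/2) ^ s)]
  congr 1
  rw [← ENNReal.tsum_mul_left]
  refine tsum_congr fun j => ?_
  rw [ENNReal.tsum_mul_right, dySum_shift_left]

/-- the annuli -/
def ann (n : ℕ) (k : ℤ) : Set (Eucl n) :=
  Metric.ball (0 : Eucl n) ((2:ℝ) ^ k) \ Metric.ball (0 : Eucl n) ((2:ℝ) ^ (k-1))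

lemma measurableSet_ann (n : ℕ) (k : ℤ) : MeasurableSet (ann n k) :=
  Metric.isOpen_ball.measurableSet.diff Metric.isOpen_ball.measurableSet

lemma ofReal_two_zpow (k : ℤ) : ENNReal.ofReal ((2:ℝ) ^ k) = 2 ^ (k : ℝ) := by
  rw [← Real.rpow_intCast, ← ENNReal.ofReal_rpow_of_pos (by norm_num)]
  simp

lemma ann_bounds {n : ℕ} {k : ℤ} {x : Eucl n} (hx : x ∈ ann n k) :
    (2 : ℝ≥0∞) ^ ((k : ℝ) - 1) ≤ ‖x‖ₑ ∧ ‖x‖ₑ ≤ 2 ^ (k : ℝ) := by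
  obtain ⟨h1, h2⟩ := hx
  rw [mem_ball_zero_iff] at h1 h2
  rw [not_lt] at h2
  have e1 := ENNReal.ofReal_le_ofReal h1.le
  have e2 := ENNReal.ofReal_le_ofReal h2
  rw [ofReal_norm, ofReal_two_zpow] at e1 e2
  push_cast at e2
  exact ⟨e2, e1⟩

lemma rpow_upper {k a : ℝ} {t : ℝ≥0∞} (h1 : (2 : ℝ≥0∞) ^ (k - 1) ≤ t) (h2 : t ≤ 2 ^ k) :
    t ^ a ≤ 2 ^ |a| * 2 ^ (k * a) := by
  rcases le_total 0 a with ha | ha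
  · refine (ENNReal.rpow_le_rpow h2 ha).trans ?_
    rw [← ENNReal.rpow_mul, ← two_rpow_add]
    exact two_rpow_mono (by linarith [abs_nonneg a])
  · have := rpow_neg_anti (t := -a) (by linarith) h1
    rw [neg_neg] at this
    refine this.trans ?_
    rw [← ENNReal.rpow_mul, ← two_rpow_add, abs_of_nonpos ha]
    exact two_rpow_mono (by linarith)

lemma rpow_lower {k a : ℝ} {t : ℝ≥0∞} (h1 : (2 : ℝ≥0∞) ^ (k - 1) ≤ t) (h2 : t ≤ 2 ^ k) :
    2 ^ (-|a|) * 2 ^ (k * a) ≤ t ^ a := by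
  rcases le_total 0 a with ha | ha
  · refine le_trans ?_ (ENNReal.rpow_le_rpow h1 ha)
    rw [← ENNReal.rpow_mul, ← two_rpow_add, abs_of_nonneg ha]
    exact two_rpow_mono (by linarith)
  · have := rpow_neg_anti (t := -a) (by linarith) h2
    rw [neg_neg] at this
    refine le_trans ?_ this
    rw [← ENNReal.rpow_mul, ← two_rpow_add]
    exact two_rpow_mono (by linarith [abs_nonneg a])

lemma iUnion_ann (n : ℕ) {x : Eucl n} (hx : x ≠ 0) : x ∈ ⋃ k, ann n k := by
  obtain ⟨k, h1, h2⟩ := exists_mem_Ico_zpow (norm_pos_iff.2 hx) (show (1:ℝ) < 2 by norm_num)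
  refine Set.mem_iUnion.2 ⟨k + 1, ?_, ?_⟩
  · rwa [mem_ball_zero_iff]
  · rw [mem_ball_zero_iff, add_sub_cancel_right, not_lt]; exact h1

lemma lintegral_le_ann {n : ℕ} (hn : 1 ≤ n) (F : Eucl n → ℝ≥0∞) :
    ∫⁻ x, F x ≤ ∑' j : ℤ, ∫⁻ x in ann n j, F x := by
  have : ∫⁻ x, F x = ∫⁻ x in ⋃ j, ann n j, F x := by
    have h : (⋃ j, ann n j) =ᵐ[volume] Set.univ := by
      rw [ae_eq_univ]
      refine measure_mono_null ?_ (ae_iff.1 (ae_ne_zero hn))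
      intro x hx
      simp only [Set.mem_ofPred_eq, not_not]
      by_contra h0
      exact hx (iUnion_ann n h0)
    rw [Measure.restrict_congr_set h, Measure.restrict_univ]
  rw [this]
  exact lintegral_iUnion_le _ _

lemma min_weight_lower {n : ℕ} {a b : ℝ} {k : ℤ} {x : Eucl n} (hx : x ∈ ann n k) :
    2 ^ (-(|a| + |b|)) ≤ min ((2:ℝ≥0∞) ^ (-(k * a)) * ‖x‖ₑ ^ a) ((2:ℝ≥0∞) ^ (-(k * b)) * ‖x‖ₑ ^ b) := by
  obtain ⟨h1, h2⟩ := ann_bounds hx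
  refine le_min ?_ ?_
  · refine le_trans ?_ (mul_le_mul_right (rpow_lower (a := a) h1 h2) _)
    rw [← two_rpow_add, ← two_rpow_add]
    exact two_rpow_mono (by linarith [abs_nonneg b])
  · refine le_trans ?_ (mul_le_mul_right (rpow_lower (a := b) h1 h2) _)
    rw [← two_rpow_add, ← two_rpow_add]
    exact two_rpow_mono (by linarith [abs_nonneg a])

lemma min_weight_upper {n : ℕ} {a b β ε : ℝ} (ha : ε ≤ β - a) (hb : ε ≤ b - β) {k j : ℤ} {x : Eucl n}
    (hx : x ∈ ann n j) :
    min ((2:ℝ≥0∞) ^ (-(k * a)) * ‖x‖ₑ ^ a) ((2:ℝ≥0∞) ^ (-(k * b)) * ‖x‖ₑ ^ b) ≤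
      2 ^ (|a| + |b| - k * β) * (2 ^ (-(ε * |((j - k : ℤ) : ℝ)|)) * 2 ^ (j * β)) := by
  obtain ⟨h1, h2⟩ := ann_bounds hx
  push_cast
  rcases le_total 0 ((j : ℝ) - k) with h | h
  · refine (min_le_left _ _).trans ((mul_le_mul_right (rpow_upper (a := a) h1 h2) _).trans ?_)
    rw [← two_rpow_add, ← two_rpow_add, ← two_rpow_add, ← two_rpow_add]
    refine two_rpow_mono ?_
    rw [abs_of_nonneg h]
    nlinarith [abs_nonneg b, mul_le_mul_of_nonneg_right ha h]
  · refine (min_le_right _ _).trans ((mul_le_mul_right (rpow_upper (a := b) h1 h2) _).trans ?_)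
    rw [← two_rpow_add, ← two_rpow_add, ← two_rpow_add, ← two_rpow_add]
    refine two_rpow_mono ?_
    rw [abs_of_nonpos h]
    nlinarith [abs_nonneg a, mul_le_mul_of_nonpos_right hb h]

lemma herz_eq (n : ℕ) {α u q : ℝ} (hu : 1 < u) (hq : 1 ≤ q) (h : Eucl n → ℝ) :
    herzNorm n α u q h = (∑' k : ℤ, ((2 : ℝ≥0∞) ^ ((k : ℝ) * (α * u)) *
      ∫⁻ y in ann n k, (‖h y‖₊ : ℝ≥0∞) ^ u) ^ (q/u)) ^ (1/q) := by
  have hu0 : 0 < u := by linarith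
  unfold herzNorm
  congr 1
  refine tsum_congr fun k => ?_
  change ((2 : ℝ≥0∞) ^ ((k : ℝ) * α) * (∫⁻ y in ann n k, (‖h y‖₊ : ℝ≥0∞) ^ u) ^ (1/u)) ^ q = _
  have e : (2 : ℝ≥0∞) ^ ((k : ℝ) * α) = ((2 : ℝ≥0∞) ^ ((k : ℝ) * (α * u))) ^ (1/u) := by
    rw [← ENNReal.rpow_mul]; congr 1; field_simp
  rw [e, ← ENNReal.mul_rpow_of_nonneg _ _ (by positivity), ← ENNReal.rpow_mul]
  congr 1; ring

theorem extrapolation_herz (n : ℕ) (hn : 1 ≤ n) (u q α : ℝ)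
    (hu : 1 < u) (hq : 1 ≤ q)
    (hα1 : -((n : ℝ)/u) < α) (hα2 : α < (n : ℝ) - (n : ℝ)/u)
    (p : ℝ) (hp : 1 < p)
    (N : ℝ → ℝ) (hN : MonotoneOn N (Set.Ici 1)) (hNpos : ∀ t, 1 ≤ t → 0 < N t) :
    ∃ C : ℝ, 0 < C ∧ ∀ f g : Eucl n → ℝ, memF n p N f g →
      herzNorm n α u q f ≤ ENNReal.ofReal C * herzNorm n α u q g := by
  have hu0 : 0 < u := by linarith
  have hq0 : 0 < q := by linarith
  set β := α * u with hβ
  have hβ1 : -(n:ℝ) < β := by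
    have := mul_lt_mul_of_pos_right hα1 hu0
    rwa [neg_mul, div_mul_cancel₀ _ hu0.ne'] at this
  have hβ2 : β < n * (u - 1) := by
    have := mul_lt_mul_of_pos_right hα2 hu0
    rw [sub_mul, div_mul_cancel₀ _ hu0.ne'] at this
    linarith
  set a := (β - n) / 2 with ha
  set b := (β + n * (u - 1)) / 2 with hb
  set ε := min (β - a) (b - β) with hε
  have hε0 : 0 < ε := lt_min (by rw [ha]; linarith) (by rw [hb]; linarith)
  obtain ⟨K, hK, hKw⟩ := min_power_weight hn hu (a := a) (b := b) (by rw [ha]; linarith) (by rw [ha]; linarith)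
    (by rw [hb]; linarith) (by rw [hb]; linarith)
  obtain ⟨C, hC, hext⟩ := extrap n hp hu hN hK
  set M := |a| + |b| with hM
  set s := q / u with hs
  have hs0 : 0 < s := by positivity
  set C1 : ℝ≥0∞ := 2 ^ (2 * M) * C with hC1
  have hC1t : C1 ≠ ⊤ := ENNReal.mul_ne_top (two_rpow_ne_top _) hC
  set D : ℝ≥0∞ := (C1 ^ s * dySum (ε/2) ^ s * dySum (s * (ε/2))) ^ (1/q) with hD
  have hDt : D ≠ ⊤ := by
    refine ENNReal.rpow_ne_top_of_nonneg (by positivity) (ENNReal.mul_ne_top (ENNReal.mul_ne_top ?_ ?_) ?_)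
    · exact ENNReal.rpow_ne_top_of_nonneg hs0.le hC1t
    · exact ENNReal.rpow_ne_top_of_nonneg hs0.le (dySum_ne_top (by positivity))
    · exact dySum_ne_top (by positivity)
  refine ⟨D.toReal + 1, by positivity, ?_⟩
  intro f g hfg
  have hfin : herzNorm n α u q f ≤ D * herzNorm n α u q g := by
    rw [herz_eq n hu hq, herz_eq n hu hq, hD, ← ENNReal.mul_rpow_of_nonneg _ _ (by positivity)]
    refine ENNReal.rpow_le_rpow (young_seq hs0 ?_) (by positivity)
    intro k
    set w : Eucl n → ℝ≥0∞ := fun x =>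
      min ((2:ℝ≥0∞) ^ (-(k * a)) * ‖x‖ₑ ^ a) ((2:ℝ≥0∞) ^ (-(k * b)) * ‖x‖ₑ ^ b) with hw
    obtain ⟨hww, hwK⟩ := hKw _ _ (two_rpow_ne_zero (-(k * a))) (two_rpow_ne_top _) (two_rpow_ne_zero (-(k * b)))
      (two_rpow_ne_top _)
    have h1 := hext w hww hwK f g hfg
    set F : Eucl n → ℝ≥0∞ := fun x => (‖f x‖₊ : ℝ≥0∞) ^ u with hF
    set G : Eucl n → ℝ≥0∞ := fun x => (‖g x‖₊ : ℝ≥0∞) ^ u with hG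
    have hFm : Measurable F := hfg.1.nnnorm.coe_nnreal_ennreal.pow_const _
    have hGm : Measurable G := hfg.2.1.nnnorm.coe_nnreal_ennreal.pow_const _
    change ∫⁻ x, F x * w x ≤ C * ∫⁻ x, G x * w x at h1
    change 2 ^ ((k:ℝ) * β) * ∫⁻ y in ann n k, F y ≤ C1 * ∑' j : ℤ, 2 ^ (-(ε * |((j - k : ℤ) : ℝ)|)) *
      (2 ^ ((j:ℝ) * β) * ∫⁻ y in ann n j, G y)
    have hlow : 2 ^ (-M) * ∫⁻ y in ann n k, F y ≤ ∫⁻ x, F x * w x := by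
      rw [← lintegral_const_mul _ hFm]
      refine le_trans ?_ (setLIntegral_le_lintegral (ann n k) _)
      refine setLIntegral_mono (hFm.mul hww.1) fun x hx => ?_
      rw [mul_comm]
      exact mul_le_mul_right (min_weight_lower hx) _
    have hup : ∫⁻ x, G x * w x ≤ 2 ^ (M - k * β) * ∑' j : ℤ, 2 ^ (-(ε * |((j - k : ℤ) : ℝ)|)) *
      (2 ^ ((j:ℝ) * β) * ∫⁻ y in ann n j, G y) := by
      refine (lintegral_le_ann hn _).trans ?_
      rw [← ENNReal.tsum_mul_left]
      refine ENNReal.tsum_le_tsum fun j => ?_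
      have e : (2:ℝ≥0∞) ^ (M - k * β) * (2 ^ (-(ε * |((j - k : ℤ) : ℝ)|)) * (2 ^ ((j:ℝ) * β) * ∫⁻ y in ann n j, G y))
          = ∫⁻ y in ann n j, (2 ^ (M - k * β) * (2 ^ (-(ε * |((j - k : ℤ) : ℝ)|)) * 2 ^ ((j:ℝ) * β))) * G y := by
        rw [lintegral_const_mul _ hGm]; ring
      rw [e]
      refine setLIntegral_mono (hGm.const_mul _) fun x hx => ?_
      rw [mul_comm]
      exact mul_le_mul_left (min_weight_upper (min_le_left _ _) (min_le_right _ _) hx) _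
    have h2 := hlow.trans (h1.trans (mul_le_mul_right hup _))
    set T0 := ∑' j : ℤ, (2:ℝ≥0∞) ^ (-(ε * |((j - k : ℤ) : ℝ)|)) * (2 ^ ((j:ℝ) * β) * ∫⁻ y in ann n j, G y)
    have h3 := mul_le_mul_right h2 ((2:ℝ≥0∞) ^ (M + k * β))
    have e1 : (2:ℝ≥0∞) ^ ((k:ℝ) * β) = 2 ^ (M + k * β) * 2 ^ (-M) := by
      rw [← two_rpow_add]; congr 1; ring
    have e2 : (2:ℝ≥0∞) ^ (2 * M) = 2 ^ (M + k * β) * 2 ^ (M - k * β) := by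
      rw [← two_rpow_add]; congr 1; ring
    rw [e1, hC1, e2, mul_assoc]
    refine h3.trans (le_of_eq ?_)
    ring
  refine hfin.trans (mul_le_mul_left ?_ _)
  rw [ENNReal.le_ofReal_iff_toReal_le hDt (by positivity)]
  linarith
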